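/- arXiv:2009.12337 — 6 statements merged into one kernel-verified Lean document; each statement's English description precedes it below -/
import Mathlib

section
/- Let n ≥ 2 be an integer and let U_1,...,U_n be i.i.d. uniform on (0,1), with minimum U_(1) and maximum U_(n). Then the Kullback–Leibler divergence between the joint law of (U_(1), U_(n)) and the product of the laws of U_(1) and U_(n) equals log((n−1)/n) + 1/(n−1). -/
open MeasureTheory Real Filter Topology Classical

noncomputable section

/-- Kullback–Leibler divergence: `∫ log (dP/dQ) dP` when `P ≪ Q`, and `+∞` otherwise. -/
def klDiv {α : Type*} [MeasurableSpace α] (P Q : Measure α) : EReal :=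
  if P ≪ Q then ((∫ x, Real.log ((P.rnDeriv Q x).toReal) ∂P : ℝ) : EReal) else ⊤

/-- The nondecreasing rearrangement of a tuple: `sortTuple x i` is the `i`-th order
statistic (0-indexed) of the vector `x`. -/
def sortTuple {n : ℕ} (x : Fin n → ℝ) : Fin n → ℝ := x ∘ Tuple.sort x

/-- Law of an i.i.d. sample of size `n` from `μ`. -/
def sampleLaw (n : ℕ) (μ : Measure ℝ) : Measure (Fin n → ℝ) := Measure.pi fun _ => μ

/-- Law of the `i`-th order statistic (0-indexed) of an i.i.d. sample of size `n` from `μ`. -/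
def osLaw (n : ℕ) (μ : Measure ℝ) (i : Fin n) : Measure ℝ :=
  (sampleLaw n μ).map fun x => sortTuple x i

/-- Joint law of the order statistics indexed by `I`. -/
def orderLaw (n : ℕ) (μ : Measure ℝ) (I : Finset (Fin n)) : Measure (I → ℝ) :=
  (sampleLaw n μ).map fun x (i : I) => sortTuple x i.1

/-- Product of the marginal laws of the order statistics indexed by `I`. -/
def orderProdLaw (n : ℕ) (μ : Measure ℝ) (I : Finset (Fin n)) : Measure (I → ℝ) :=
  Measure.pi fun i : I => osLaw n μ i.1

/-- Mutual information between two tuples of order statistics. -/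
def miTuples (n : ℕ) (μ : Measure ℝ) (I₁ I₂ : Finset (Fin n)) : EReal :=
  klDiv
    ((sampleLaw n μ).map fun x =>
      ((fun i : I₁ => sortTuple x i.1), (fun i : I₂ => sortTuple x i.1)))
    ((orderLaw n μ I₁).prod (orderLaw n μ I₂))

/-- Mutual information between two single order statistics (0-indexed). -/
def miPair (n : ℕ) (μ : Measure ℝ) (r m : Fin n) : EReal :=
  klDiv ((sampleLaw n μ).map fun x => (sortTuple x r, sortTuple x m))
    ((osLaw n μ r).prod (osLaw n μ m))

/-- The uniform probability measure on `(0,1)`. -/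
def unif : Measure ℝ := volume.restrict (Set.Ioo 0 1)

/-- `T r = log (r!) - r * H_r`. -/
def T (r : ℕ) : ℝ := Real.log (Nat.factorial r) - r * (harmonic r : ℝ)

lemma sort_gt {n : ℕ} (x : Fin n → ℝ) (h : 0 < n) (a : ℝ) :
    a < sortTuple x ⟨0, h⟩ ↔ ∀ i, a < x i := by
  constructor
  · intro ha i
    have := Tuple.monotone_sort x (show (⟨0, h⟩ : Fin n) ≤ (Tuple.sort x).symm i from Nat.zero_le _)
    simp only [Function.comp_apply, Equiv.apply_symm_apply] at this
    exact lt_of_lt_of_le ha this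
  · intro ha
    exact ha _

lemma sort_ge {n : ℕ} (x : Fin n → ℝ) (h : 0 < n) (a : ℝ) :
    a ≤ sortTuple x ⟨0, h⟩ ↔ ∀ i, a ≤ x i := by
  constructor
  · intro ha i
    have := Tuple.monotone_sort x (show (⟨0, h⟩ : Fin n) ≤ (Tuple.sort x).symm i from Nat.zero_le _)
    simp only [Function.comp_apply, Equiv.apply_symm_apply] at this
    exact ha.trans this
  · intro ha
    exact ha _

lemma sort_le {n : ℕ} (x : Fin n → ℝ) (h : n - 1 < n) (b : ℝ) :
    sortTuple x ⟨n - 1, h⟩ ≤ b ↔ ∀ i, x i ≤ b := by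
  constructor
  · intro ha i
    have := Tuple.monotone_sort x (show (Tuple.sort x).symm i ≤ (⟨n - 1, h⟩ : Fin n) from
      Nat.le_sub_one_of_lt (Fin.is_lt _))
    simp only [Function.comp_apply, Equiv.apply_symm_apply] at this
    exact le_trans this ha
  · intro ha
    exact ha _

lemma meas_min {n : ℕ} (h : 0 < n) : Measurable fun x : Fin n → ℝ => sortTuple x ⟨0, h⟩ := by
  refine measurable_of_Ioi fun a => ?_
  have : (fun x : Fin n → ℝ => sortTuple x ⟨0, h⟩) ⁻¹' Set.Ioi a
      = Set.univ.pi fun _ => Set.Ioi a := by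
    ext x
    simp [sort_gt]
  rw [this]
  exact MeasurableSet.univ_pi fun _ => measurableSet_Ioi

lemma meas_max {n : ℕ} (h : n - 1 < n) :
    Measurable fun x : Fin n → ℝ => sortTuple x ⟨n - 1, h⟩ := by
  refine measurable_of_Iic fun a => ?_
  have : (fun x : Fin n → ℝ => sortTuple x ⟨n - 1, h⟩) ⁻¹' Set.Iic a
      = Set.univ.pi fun _ => Set.Iic a := by
    ext x
    simp only [Set.mem_preimage, Set.mem_Iic, sort_le, Set.mem_pi, Set.mem_univ, true_imp_iff]
  rw [this]
  exact MeasurableSet.univ_pi fun _ => measurableSet_Iic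

instance unif_prob : IsProbabilityMeasure unif := ⟨by simp [unif]⟩

instance sample_prob (n : ℕ) : IsProbabilityMeasure (sampleLaw n unif) := by
  unfold sampleLaw; infer_instance

lemma unif_Ioc (a b : ℝ) :
    unif (Set.Ioc a b) = ENNReal.ofReal (min b 1 - max a 0) := by
  unfold unif
  rw [Measure.restrict_congr_set Ioo_ae_eq_Ioc, Measure.restrict_apply measurableSet_Ioc,
    Set.Ioc_inter_Ioc, Real.volume_Ioc]

lemma unif_Ici (a : ℝ) :
    unif (Set.Ici a) = ENNReal.ofReal (1 - max a 0) := by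
  unfold unif
  rw [Measure.restrict_congr_set Ioo_ae_eq_Ico, Measure.restrict_apply measurableSet_Ici,
    Set.inter_comm, Set.Ico_inter_Ici, Real.volume_Ico, max_comm]

lemma unif_Iic (b : ℝ) :
    unif (Set.Iic b) = ENNReal.ofReal (min b 1) := by
  unfold unif
  rw [Measure.restrict_congr_set Ioo_ae_eq_Ioc, Measure.restrict_apply measurableSet_Iic,
    Set.inter_comm, Set.Ioc_inter_Iic, Real.volume_Ioc, min_comm, sub_zero]

lemma lint_pow_left (m : ℕ) (c d : ℝ) (h : c ≤ d) :
    ∫⁻ t in Set.Ioo c d, ENNReal.ofReal ((m + 1) * (t - c) ^ m)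
      = ENNReal.ofReal ((d - c) ^ (m + 1)) := by
  rw [Measure.restrict_congr_set Ioo_ae_eq_Ioc, ← ofReal_integral_eq_lintegral_ofReal]
  · rw [← intervalIntegral.integral_of_le h]
    congr 1
    rw [intervalIntegral.integral_comp_sub_right (fun t => ((m : ℝ) + 1) * t ^ m)]
    simp
    field_simp
  · exact (Continuous.intervalIntegrable (by fun_prop) c d).1
  · refine (ae_restrict_iff' measurableSet_Ioc).2 (.of_forall fun t ht => ?_)
    have := sub_pos.2 ht.1
    simp only [Pi.zero_apply]
    positivity

lemma lint_pow_right (m : ℕ) (c d : ℝ) (h : c ≤ d) :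
    ∫⁻ t in Set.Ioo c d, ENNReal.ofReal ((m + 1) * (d - t) ^ m)
      = ENNReal.ofReal ((d - c) ^ (m + 1)) := by
  rw [Measure.restrict_congr_set Ioo_ae_eq_Ioc, ← ofReal_integral_eq_lintegral_ofReal]
  · rw [← intervalIntegral.integral_of_le h]
    congr 1
    rw [intervalIntegral.integral_comp_sub_left (fun t => ((m : ℝ) + 1) * t ^ m)]
    simp
    field_simp
  · exact (Continuous.intervalIntegrable (by fun_prop) c d).1
  · refine (ae_restrict_iff' measurableSet_Ioc).2 (.of_forall fun t ht => ?_)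
    have := sub_nonneg.2 ht.2
    simp only [Pi.zero_apply]
    positivity

lemma int_pow_log (m : ℕ) (y : ℝ) (hy : 0 ≤ y) :
    ∫ t in (0:ℝ)..y, t ^ m * Real.log t
      = y ^ (m + 1) * Real.log y / (m + 1) - y ^ (m + 1) / (m + 1) ^ 2 := by
  have key := intervalIntegral.integral_eq_sub_of_hasDerivAt_of_le
    (f := fun t : ℝ => t ^ m * (t * Real.log t) / (m + 1) - t ^ (m + 1) / (m + 1) ^ 2)
    (f' := fun t => t ^ m * Real.log t) hy ?_ ?_ ?_
  · rw [key]
    simp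
    ring
  · have := Real.continuous_mul_log
    exact Continuous.continuousOn (by fun_prop)
  · intro t ht
    have ht0 : t ≠ 0 := ht.1.ne'
    have h1 := (((hasDerivAt_pow (m+1) t).mul (Real.hasDerivAt_log ht0)).div_const ((m:ℝ)+1)).sub
      ((hasDerivAt_pow (m+1) t).div_const (((m:ℝ)+1)^2))
    convert h1 using 1
    · ext s
      simp only [Pi.mul_apply, Pi.sub_apply]; ring
    · simp; field_simp; ring
  · exact (intervalIntegral.intervalIntegrable_log').continuousOn_mul (by fun_prop)

lemma ii_pow_log (m : ℕ) (a b : ℝ) :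
    IntervalIntegrable (fun t : ℝ => t ^ m * Real.log t) volume a b :=
  (intervalIntegral.intervalIntegrable_log').continuousOn_mul (by fun_prop)

lemma sample_pi (n : ℕ) (s : Set ℝ) :
    sampleLaw n unif (Set.univ.pi fun _ => s) = unif s ^ n := by
  unfold sampleLaw
  rw [Measure.pi_pi]
  simp

def triS : Set (ℝ × ℝ) := {p | 0 < p.1 ∧ p.1 < p.2 ∧ p.2 < 1}

lemma meas_triS : MeasurableSet triS := by
  unfold triS
  refine MeasurableSet.inter (measurableSet_lt measurable_const measurable_fst) ?_
  exact MeasurableSet.inter (measurableSet_lt measurable_fst measurable_snd)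
    (measurableSet_lt measurable_snd measurable_const)

def fJ (k : ℕ) : ℝ × ℝ → ENNReal :=
  triS.indicator fun p => ENNReal.ofReal (((k : ℝ) + 2) * (k + 1) * (p.2 - p.1) ^ k)

def gMin (k : ℕ) : ℝ → ENNReal :=
  (Set.Ioo 0 1).indicator fun x => ENNReal.ofReal (((k : ℝ) + 2) * (1 - x) ^ (k + 1))

def gMax (k : ℕ) : ℝ → ENNReal :=
  (Set.Ioo 0 1).indicator fun x => ENNReal.ofReal (((k : ℝ) + 2) * x ^ (k + 1))

def rD (k : ℕ) : ℝ × ℝ → ENNReal :=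
  triS.indicator fun p => ENNReal.ofReal
    (((k : ℝ) + 1) * (p.2 - p.1) ^ k / ((k + 2) * (1 - p.1) ^ (k + 1) * p.2 ^ (k + 1)))

lemma meas_fJ (k : ℕ) : Measurable (fJ k) :=
  Measurable.indicator (by fun_prop) meas_triS

lemma meas_rD (k : ℕ) : Measurable (rD k) :=
  Measurable.indicator (by fun_prop) meas_triS

lemma meas_gMin (k : ℕ) : Measurable (gMin k) :=
  Measurable.indicator (by fun_prop) measurableSet_Ioo

lemma meas_gMax (k : ℕ) : Measurable (gMax k) :=
  Measurable.indicator (by fun_prop) measurableSet_Ioo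

lemma fJ_eq (k : ℕ) : fJ k = (fun z : ℝ × ℝ => gMin k z.1 * gMax k z.2) * rD k := by
  ext p
  simp only [Pi.mul_apply, fJ, rD]
  by_cases hp : p ∈ triS
  · have h := hp
    obtain ⟨h0, h1, h2⟩ := h
    have e1 : p.1 ∈ Set.Ioo (0:ℝ) 1 := ⟨h0, h1.trans h2⟩
    have e2 : p.2 ∈ Set.Ioo (0:ℝ) 1 := ⟨h0.trans h1, h2⟩
    have p1 : 0 < 1 - p.1 := by linarith
    have p2 : 0 < p.2 := by linarith
    have p3 : 0 < p.2 - p.1 := by linarith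
    rw [Set.indicator_of_mem hp, Set.indicator_of_mem hp, gMin, gMax, Set.indicator_of_mem e1,
      Set.indicator_of_mem e2, ← ENNReal.ofReal_mul (by positivity),
      ← ENNReal.ofReal_mul (by positivity)]
    congr 1
    field_simp
  · simp [Set.indicator_of_notMem hp]

lemma law_min (k : ℕ) (h : 0 < k + 2) :
    osLaw (k + 2) unif ⟨0, h⟩ = volume.withDensity (gMin k) := by
  have : IsProbabilityMeasure (osLaw (k + 2) unif ⟨0, h⟩) :=
    Measure.isProbabilityMeasure_map (meas_min h).aemeasurable
  refine Measure.ext_of_Ici _ _ fun a => ?_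
  have hs : (fun x : Fin (k + 2) → ℝ => sortTuple x ⟨0, h⟩) ⁻¹' Set.Ici a
      = Set.univ.pi fun _ => Set.Ici a := by
    ext x
    simp only [Set.mem_preimage, Set.mem_Ici, sort_ge, Set.mem_pi, Set.mem_univ, true_imp_iff]
  have hae : (Set.Ioo 0 1 ∩ Set.Ici a : Set ℝ) =ᵐ[volume] (Set.Ico 0 1 ∩ Set.Ici a : Set ℝ) :=
    Ioo_ae_eq_Ico.inter (ae_eq_refl _)
  rw [osLaw, Measure.map_apply (meas_min h) measurableSet_Ici, hs, sample_pi, unif_Ici,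
    withDensity_apply _ measurableSet_Ici, gMin, setLIntegral_indicator measurableSet_Ioo,
    Measure.restrict_congr_set hae, Set.Ico_inter_Ici,
    ← Measure.restrict_congr_set Ioo_ae_eq_Ico, max_comm]
  rcases le_total (max 0 a) 1 with h1 | h1
  · have := lint_pow_right (k + 1) (max 0 a) 1 h1
    push_cast at this
    rw [show (k : ℝ) + 1 + 1 = k + 2 by ring] at this
    rw [this, ENNReal.ofReal_pow (by linarith)]
  · rw [ENNReal.ofReal_of_nonpos (by linarith), Set.Ioo_eq_empty (not_lt.2 h1)]
    simp

lemma law_max (k : ℕ) (h : k + 2 - 1 < k + 2) :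
    osLaw (k + 2) unif ⟨k + 2 - 1, h⟩ = volume.withDensity (gMax k) := by
  have : IsProbabilityMeasure (osLaw (k + 2) unif ⟨k + 2 - 1, h⟩) :=
    Measure.isProbabilityMeasure_map (meas_max h).aemeasurable
  refine Measure.ext_of_Iic _ _ fun b => ?_
  have hs : (fun x : Fin (k + 2) → ℝ => sortTuple x ⟨k + 2 - 1, h⟩) ⁻¹' Set.Iic b
      = Set.univ.pi fun _ => Set.Iic b := by
    ext x
    simp only [Set.mem_preimage, Set.mem_Iic, sort_le, Set.mem_pi, Set.mem_univ, true_imp_iff]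
  have hae : (Set.Ioo 0 1 ∩ Set.Iic b : Set ℝ) =ᵐ[volume] (Set.Ioc 0 1 ∩ Set.Iic b : Set ℝ) :=
    Ioo_ae_eq_Ioc.inter (ae_eq_refl _)
  rw [osLaw, Measure.map_apply (meas_max h) measurableSet_Iic, hs, sample_pi, unif_Iic,
    withDensity_apply _ measurableSet_Iic, gMax, setLIntegral_indicator measurableSet_Ioo,
    Measure.restrict_congr_set hae, Set.Ioc_inter_Iic,
    ← Measure.restrict_congr_set Ioo_ae_eq_Ioc, min_comm]
  rcases le_total 0 (min 1 b) with h1 | h1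
  · have := lint_pow_left (k + 1) 0 (min 1 b) h1
    push_cast at this
    rw [show (k : ℝ) + 1 + 1 = k + 2 by ring] at this
    simp only [sub_zero] at this
    rw [this, ENNReal.ofReal_pow h1]
  · rw [ENNReal.ofReal_of_nonpos h1, Set.Ioo_eq_empty (not_lt.2 h1)]
    simp

lemma lint_joint (k : ℕ) (a b : ℝ) :
    (volume.withDensity (fJ k)) (Set.Ioi a ×ˢ Set.Iic b)
      = ENNReal.ofReal (min b 1 - max a 0) ^ (k + 2) := by
  have hm : MeasurableSet (Set.Ioi a ×ˢ Set.Iic b) := measurableSet_Ioi.prod measurableSet_Iic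
  set a' := max a 0 with ha'
  set b' := min b 1 with hb'
  rw [withDensity_apply _ hm, ← lintegral_indicator hm, Measure.volume_eq_prod,
    lintegral_prod_symm _ ((meas_fJ k).indicator hm).aemeasurable]
  have inner : ∀ᵐ y : ℝ, ∫⁻ x, (Set.Ioi a ×ˢ Set.Iic b).indicator (fJ k) (x, y)
      = (Set.Ioo a' b').indicator
        (fun y => ENNReal.ofReal (((k : ℝ) + 2) * (y - a') ^ (k + 1))) y := by
    have hne : ∀ᵐ y : ℝ, y ≠ b := by simp [ae_iff]
    filter_upwards [hne] with y hyb
    have e : (fun x => (Set.Ioi a ×ˢ Set.Iic b).indicator (fJ k) (x, y))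
        = (Set.Ioo a' y).indicator fun x => if y < b' then
          ENNReal.ofReal (((k : ℝ) + 2) * (k + 1) * (y - x) ^ k) else 0 := by
      ext x
      have hyb2 : y ≤ b ↔ y < b := ⟨fun h => lt_of_le_of_ne h hyb, le_of_lt⟩
      simp only [Set.indicator_apply, fJ, triS, Set.mem_prod, Set.mem_Ioi, Set.mem_Iic, Set.mem_Ioo,
        Set.mem_ofPred_eq, ha', hb', max_lt_iff, lt_min_iff, hyb2]
      by_cases c1 : a < x <;> by_cases c2 : 0 < x <;> by_cases c3 : x < y <;>
        by_cases c4 : y < b <;> by_cases c5 : y < 1 <;> simp [c1, c2, c3, c4, c5]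
    rw [e, lintegral_indicator measurableSet_Ioo]
    by_cases hy : y ∈ Set.Ioo a' b'
    · rw [Set.indicator_of_mem hy]
      simp only [hy.2, if_true]
      have := lint_pow_right k a' y hy.1.le
      simp_rw [mul_assoc ((k : ℝ) + 2), ENNReal.ofReal_mul (show (0:ℝ) ≤ k + 2 by positivity)]
      rw [lintegral_const_mul _ (by fun_prop), this]
    · rw [Set.indicator_of_notMem hy]
      by_cases h1 : y < b'
      · have : ¬ a' < y := fun h => hy ⟨h, h1⟩
        rw [Set.Ioo_eq_empty this]
        simp
      · simp [h1]
  rw [lintegral_congr_ae inner, lintegral_indicator measurableSet_Ioo]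
  rcases le_total a' b' with h1 | h1
  · have := lint_pow_left (k + 1) a' b' h1
    push_cast at this
    rw [show (k : ℝ) + 1 + 1 = k + 2 by ring] at this
    rw [this, ENNReal.ofReal_pow (by linarith)]
  · rw [ENNReal.ofReal_of_nonpos (by linarith), Set.Ioo_eq_empty (by simpa using h1)]
    simp

lemma law_joint (k : ℕ) (h : 0 < k + 2) (h' : k + 2 - 1 < k + 2) :
    ((sampleLaw (k + 2) unif).map fun x => (sortTuple x ⟨0, h⟩, sortTuple x ⟨k + 2 - 1, h'⟩))
      = volume.withDensity (fJ k) := by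
  have hmm := (meas_min h).prodMk (meas_max h')
  have : IsProbabilityMeasure ((sampleLaw (k + 2) unif).map
      fun x => (sortTuple x ⟨0, h⟩, sortTuple x ⟨k + 2 - 1, h'⟩)) :=
    Measure.isProbabilityMeasure_map hmm.aemeasurable
  have sp1 : IsCountablySpanning (Set.range (Set.Ioi : ℝ → Set ℝ)) := by
    refine ⟨fun i : ℕ => Set.Ioi (-(i : ℝ)), fun i => ⟨_, rfl⟩, ?_⟩
    ext x
    obtain ⟨m, hm⟩ := exists_nat_gt (-x)
    simp only [Set.mem_iUnion, Set.mem_Ioi, Set.mem_univ, iff_true]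
    exact ⟨m, by linarith⟩
  have sp2 : IsCountablySpanning (Set.range (Set.Iic : ℝ → Set ℝ)) := by
    refine ⟨fun i : ℕ => Set.Iic (i : ℝ), fun i => ⟨_, rfl⟩, ?_⟩
    ext x
    obtain ⟨m, hm⟩ := exists_nat_gt x
    simp only [Set.mem_iUnion, Set.mem_Iic, Set.mem_univ, iff_true]
    exact ⟨m, hm.le⟩
  have gen := generateFrom_eq_prod (C := Set.range (Set.Ioi : ℝ → Set ℝ))
    (D := Set.range (Set.Iic : ℝ → Set ℝ))
    ((borel_eq_generateFrom_Ioi ℝ).symm.trans (BorelSpace.measurable_eq (α := ℝ)).symm)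
    ((borel_eq_generateFrom_Iic ℝ).symm.trans (BorelSpace.measurable_eq (α := ℝ)).symm) sp1 sp2
  obtain ⟨B, hB, hBu⟩ := sp1.prod sp2
  refine Measure.ext_of_generateFrom_of_iUnion _ B gen.symm
    (isPiSystem_Ioi.prod isPiSystem_Iic) hBu hB (fun i => measure_ne_top _ _) ?_
  rintro _ ⟨_, ⟨a, rfl⟩, _, ⟨b, rfl⟩, rfl⟩
  have hs : (fun x : Fin (k + 2) → ℝ => (sortTuple x ⟨0, h⟩, sortTuple x ⟨k + 2 - 1, h'⟩)) ⁻¹'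
      (Set.Ioi a ×ˢ Set.Iic b) = Set.univ.pi fun _ => Set.Ioc a b := by
    ext x
    simp only [Set.mem_preimage, Set.mem_prod, Set.mem_Ioi, Set.mem_Iic, sort_le, sort_gt,
      Set.mem_pi, Set.mem_univ, true_imp_iff, Set.mem_Ioc, forall_and]
  simp only
  rw [Measure.map_apply hmm (measurableSet_Ioi.prod measurableSet_Iic), hs, sample_pi, unif_Ioc,
    lint_joint]

lemma int_min (k : ℕ) : Integrable (fun x => Real.log (1 - x)) (volume.withDensity (gMin k)) ∧
    ∫ x, Real.log (1 - x) ∂(volume.withDensity (gMin k)) = -1 / ((k : ℝ) + 2) := by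
  have hlt : ∀ᵐ x : ℝ, gMin k x < ⊤ := by
    refine .of_forall fun x => ?_
    unfold gMin Set.indicator
    split_ifs <;> simp
  have e : (fun x => (gMin k x).toReal • Real.log (1 - x))
      = (Set.Ioo 0 1).indicator
        fun x : ℝ => ((k : ℝ) + 2) * ((1 - x) ^ (k + 1) * Real.log (1 - x)) := by
    ext x
    unfold gMin
    by_cases hx : x ∈ Set.Ioo (0:ℝ) 1
    · have := sub_pos.2 hx.2
      rw [Set.indicator_of_mem hx, Set.indicator_of_mem hx, ENNReal.toReal_ofReal (by positivity),
        smul_eq_mul, mul_assoc]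
    · simp [Set.indicator_of_notMem hx]
  rw [integrable_withDensity_iff_integrable_smul' (meas_gMin k) hlt,
    integral_withDensity_eq_integral_toReal_smul (meas_gMin k) hlt, e,
    integrable_indicator_iff measurableSet_Ioo, integral_indicator measurableSet_Ioo, IntegrableOn,
    Measure.restrict_congr_set Ioo_ae_eq_Ioc, ← intervalIntegral.integral_of_le zero_le_one]
  constructor
  · have h := ((ii_pow_log (k + 1) 1 0).comp_sub_left 1).const_mul ((k : ℝ) + 2)
    simp only [sub_self, sub_zero] at h
    exact h.1
  · rw [intervalIntegral.integral_comp_sub_left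
      (fun t => ((k : ℝ) + 2) * (t ^ (k + 1) * Real.log t)), intervalIntegral.integral_const_mul]
    simp only [sub_self, sub_zero]
    rw [int_pow_log _ _ zero_le_one]
    simp
    field_simp
    ring

lemma int_max (k : ℕ) : Integrable (fun x => Real.log x) (volume.withDensity (gMax k)) ∧
    ∫ x, Real.log x ∂(volume.withDensity (gMax k)) = -1 / ((k : ℝ) + 2) := by
  have hlt : ∀ᵐ x : ℝ, gMax k x < ⊤ := by
    refine .of_forall fun x => ?_
    unfold gMax Set.indicator
    split_ifs <;> simp
  have e : (fun x => (gMax k x).toReal • Real.log x)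
      = (Set.Ioo 0 1).indicator
        fun x : ℝ => ((k : ℝ) + 2) * (x ^ (k + 1) * Real.log x) := by
    ext x
    unfold gMax
    by_cases hx : x ∈ Set.Ioo (0:ℝ) 1
    · have := hx.1
      rw [Set.indicator_of_mem hx, Set.indicator_of_mem hx, ENNReal.toReal_ofReal (by positivity),
        smul_eq_mul, mul_assoc]
    · simp [Set.indicator_of_notMem hx]
  rw [integrable_withDensity_iff_integrable_smul' (meas_gMax k) hlt,
    integral_withDensity_eq_integral_toReal_smul (meas_gMax k) hlt, e,
    integrable_indicator_iff measurableSet_Ioo, integral_indicator measurableSet_Ioo, IntegrableOn,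
    Measure.restrict_congr_set Ioo_ae_eq_Ioc, ← intervalIntegral.integral_of_le zero_le_one]
  constructor
  · exact ((ii_pow_log (k + 1) 0 1).const_mul ((k : ℝ) + 2)).1
  · rw [intervalIntegral.integral_const_mul, int_pow_log _ _ zero_le_one]
    simp
    field_simp
    ring

lemma bound_pow_log (k : ℕ) (t : ℝ) (h0 : 0 < t) (h1 : t ≤ 1) :
    |(k : ℝ) * (t ^ k * Real.log t)| ≤ k := by
  rcases k with _ | m
  · simp
  · have hb := (Real.abs_log_mul_self_lt t h0 h1).le
    have hp : |t ^ m| ≤ 1 := by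
      rw [abs_of_pos (by positivity)]
      exact pow_le_one₀ h0.le h1
    rw [abs_mul, pow_succ, mul_assoc, mul_comm t, abs_mul (t ^ m), Nat.abs_cast]
    have : |t ^ m| * |Real.log t * t| ≤ 1 := mul_le_one₀ hp (abs_nonneg _) hb
    exact mul_le_of_le_one_right (by positivity) this

lemma int_range (k : ℕ) :
    Integrable (fun p : ℝ × ℝ => (k : ℝ) * Real.log (p.2 - p.1)) (volume.withDensity (fJ k)) ∧
    ∫ p, (k : ℝ) * Real.log (p.2 - p.1) ∂(volume.withDensity (fJ k))
      = - (k : ℝ) * (1 / (k + 1) + 1 / (k + 2)) := by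
  have hlt : ∀ᵐ x : ℝ × ℝ, fJ k x < ⊤ := by
    refine .of_forall fun x => ?_
    unfold fJ Set.indicator
    split_ifs <;> simp
  have e : (fun p => (fJ k p).toReal • ((k : ℝ) * Real.log (p.2 - p.1)))
      = triS.indicator fun p : ℝ × ℝ =>
        ((k : ℝ) + 2) * (k + 1) * (k * ((p.2 - p.1) ^ k * Real.log (p.2 - p.1))) := by
    ext p
    unfold fJ
    by_cases hp : p ∈ triS
    · have := sub_pos.2 hp.2.1
      rw [Set.indicator_of_mem hp, Set.indicator_of_mem hp, ENNReal.toReal_ofReal (by positivity),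
        smul_eq_mul]
      ring
    · simp [Set.indicator_of_notMem hp]
  have hfin : volume triS ≠ ⊤ := by
    have hsub : triS ⊆ Set.Ioo (0:ℝ) 1 ×ˢ Set.Ioo (0:ℝ) 1 := fun p hp =>
      ⟨⟨hp.1, hp.2.1.trans hp.2.2⟩, ⟨hp.1.trans hp.2.1, hp.2.2⟩⟩
    refine ne_top_of_le_ne_top ?_ (measure_mono hsub)
    rw [Measure.volume_eq_prod, Measure.prod_prod]
    simp
  have hint : Integrable (triS.indicator fun p : ℝ × ℝ =>
        ((k : ℝ) + 2) * (k + 1) * (k * ((p.2 - p.1) ^ k * Real.log (p.2 - p.1)))) := by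
    rw [integrable_indicator_iff meas_triS]
    refine Measure.integrableOn_of_bounded (M := ((k : ℝ) + 2) * (k + 1) * k) hfin
      (Measurable.aestronglyMeasurable (by fun_prop)) ?_
    refine (ae_restrict_iff' meas_triS).2 (.of_forall fun p hp => ?_)
    have h1 := bound_pow_log k (p.2 - p.1) (sub_pos.2 hp.2.1) (by linarith [hp.1, hp.2.2])
    rw [Real.norm_eq_abs, abs_mul, abs_of_nonneg (by positivity)]
    gcongr
  rw [integrable_withDensity_iff_integrable_smul' (meas_fJ k) hlt,
    integral_withDensity_eq_integral_toReal_smul (meas_fJ k) hlt, e]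
  refine ⟨hint, ?_⟩
  rw [Measure.volume_eq_prod] at hint ⊢
  rw [integral_prod_symm _ hint]
  have inner : ∀ y : ℝ, ∫ x, triS.indicator (fun p : ℝ × ℝ =>
        ((k : ℝ) + 2) * (k + 1) * (k * ((p.2 - p.1) ^ k * Real.log (p.2 - p.1)))) (x, y)
      = (Set.Ioo 0 1).indicator (fun y : ℝ => ((k : ℝ) + 2) * k * (y ^ (k + 1) * Real.log y)
          - ((k : ℝ) + 2) * k / (k + 1) * y ^ (k + 1)) y := by
    intro y
    have e2 : (fun x => triS.indicator (fun p : ℝ × ℝ =>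
        ((k : ℝ) + 2) * (k + 1) * (k * ((p.2 - p.1) ^ k * Real.log (p.2 - p.1)))) (x, y))
        = (Set.Ioo 0 y).indicator fun x => if y < 1 then
          ((k : ℝ) + 2) * (k + 1) * (k * ((y - x) ^ k * Real.log (y - x))) else 0 := by
      ext x
      simp only [Set.indicator_apply, triS, Set.mem_Ioo, Set.mem_ofPred_eq]
      by_cases c2 : 0 < x <;> by_cases c3 : x < y <;>
        by_cases c5 : y < 1 <;> simp [c2, c3, c5]
    rw [e2, integral_indicator measurableSet_Ioo]
    by_cases hy : y ∈ Set.Ioo (0:ℝ) 1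
    · rw [Set.indicator_of_mem hy]
      simp only [hy.2, if_true]
      rw [Measure.restrict_congr_set Ioo_ae_eq_Ioc, ← intervalIntegral.integral_of_le hy.1.le,
        intervalIntegral.integral_comp_sub_left
          (fun t => ((k : ℝ) + 2) * (k + 1) * (k * (t ^ k * Real.log t))),
        intervalIntegral.integral_const_mul, intervalIntegral.integral_const_mul]
      simp only [sub_self, sub_zero]
      rw [int_pow_log _ _ hy.1.le]
      field_simp
    · rw [Set.indicator_of_notMem hy]
      by_cases h1 : y < 1
      · have : ¬ 0 < y := fun h => hy ⟨h, h1⟩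
        rw [Set.Ioo_eq_empty this]
        simp
      · simp [h1]
  simp_rw [inner]
  rw [integral_indicator measurableSet_Ioo, Measure.restrict_congr_set Ioo_ae_eq_Ioc,
    ← intervalIntegral.integral_of_le zero_le_one, intervalIntegral.integral_sub
      ((ii_pow_log (k + 1) 0 1).const_mul _) (Continuous.intervalIntegrable (by fun_prop) _ _),
    intervalIntegral.integral_const_mul, intervalIntegral.integral_const_mul,
    int_pow_log _ _ zero_le_one, integral_pow]
  simp
  field_simp
  ring

/-- KL divergence between the joint law of the minimum and maximum of a uniform sample
and the product of their laws: it equals `log ((n-1)/n) + 1/(n-1)`. -/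
theorem kl_uniform_min_max
    (n : ℕ) (hn : 2 ≤ n) :
    klDiv
      ((sampleLaw n unif).map fun x =>
        (sortTuple x ⟨0, by omega⟩, sortTuple x ⟨n - 1, by omega⟩))
      ((osLaw n unif ⟨0, by omega⟩).prod (osLaw n unif ⟨n - 1, by omega⟩))
      = ((Real.log (((n : ℝ) - 1) / n) + 1 / ((n : ℝ) - 1) : ℝ) : EReal) := by
  obtain ⟨k, rfl⟩ : ∃ k, n = k + 2 := ⟨n - 2, by omega⟩
  have h : 0 < k + 2 := by omega
  have h' : k + 2 - 1 < k + 2 := by omega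
  have hmm := (meas_min h).prodMk (meas_max h')
  set P := (sampleLaw (k + 2) unif).map fun x =>
    (sortTuple x ⟨0, h⟩, sortTuple x ⟨k + 2 - 1, h'⟩) with hP
  set Q := (osLaw (k + 2) unif ⟨0, h⟩).prod (osLaw (k + 2) unif ⟨k + 2 - 1, h'⟩) with hQ
  have pP : IsProbabilityMeasure P := Measure.isProbabilityMeasure_map hmm.aemeasurable
  have p1 : IsProbabilityMeasure (osLaw (k + 2) unif ⟨0, h⟩) :=
    Measure.isProbabilityMeasure_map (meas_min h).aemeasurable
  have p2 : IsProbabilityMeasure (osLaw (k + 2) unif ⟨k + 2 - 1, h'⟩) :=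
    Measure.isProbabilityMeasure_map (meas_max h').aemeasurable
  have pQ : IsProbabilityMeasure Q := by rw [hQ]; infer_instance
  have eP : P = volume.withDensity (fJ k) := law_joint k h h'
  have eQ : Q = volume.withDensity fun z : ℝ × ℝ => gMin k z.1 * gMax k z.2 := by
    rw [hQ, law_min, law_max, prod_withDensity (meas_gMin k) (meas_gMax k),
      Measure.volume_eq_prod]
  have ePQ : P = Q.withDensity (rD k) := by
    rw [eP, eQ, fJ_eq]
    exact withDensity_mul _ (((meas_gMin k).comp measurable_fst).mul
      ((meas_gMax k).comp measurable_snd)) (meas_rD k)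
  have hac : P ≪ Q := by
    rw [ePQ]
    exact withDensity_absolutelyContinuous _ _
  have m1 : P.map Prod.fst = volume.withDensity (gMin k) := by
    rw [← law_min k h, hP, Measure.map_map measurable_fst hmm]
    rfl
  have m2 : P.map Prod.snd = volume.withDensity (gMax k) := by
    rw [← law_max k h', hP, Measure.map_map measurable_snd hmm]
    rfl
  obtain ⟨i1, v1⟩ := int_min k
  obtain ⟨i2, v2⟩ := int_max k
  obtain ⟨i3, v3⟩ := int_range k
  rw [← m1] at i1 v1
  rw [← m2] at i2 v2
  rw [← eP] at i3 v3
  rw [integrable_map_measure (Measurable.aestronglyMeasurable (by fun_prop))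
    measurable_fst.aemeasurable] at i1
  rw [integrable_map_measure (Measurable.aestronglyMeasurable (by fun_prop))
    measurable_snd.aemeasurable] at i2
  rw [integral_map measurable_fst.aemeasurable
    (Measurable.aestronglyMeasurable (by fun_prop))] at v1
  rw [integral_map measurable_snd.aemeasurable
    (Measurable.aestronglyMeasurable (by fun_prop))] at v2
  have hrn : P.rnDeriv Q =ᵐ[P] rD k := by
    refine hac.ae_eq ?_
    rw [ePQ]
    exact Measure.rnDeriv_withDensity Q (meas_rD k)
  have hS : ∀ᵐ p ∂P, p ∈ triS := by
    rw [eP, fJ, withDensity_indicator meas_triS]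
    exact (withDensity_absolutelyContinuous _ _).ae_le (ae_restrict_mem meas_triS)
  have hlog : ∀ᵐ p ∂P, Real.log ((P.rnDeriv Q p).toReal)
      = (Real.log (((k : ℝ) + 1) / (k + 2)) + k * Real.log (p.2 - p.1))
        - ((k : ℝ) + 1) * (Real.log (1 - p.1) + Real.log p.2) := by
    filter_upwards [hrn, hS] with p h1 hp
    have q1 : 0 < 1 - p.1 := by linarith [hp.2.1, hp.2.2]
    have q2 : 0 < p.2 := by linarith [hp.2.1, hp.1]
    have q3 : 0 < p.2 - p.1 := by linarith [hp.2.1]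
    rw [h1, rD, Set.indicator_of_mem hp, ENNReal.toReal_ofReal (by positivity),
      Real.log_div (by positivity) (by positivity), Real.log_mul (by positivity) (by positivity),
      Real.log_mul (by positivity) (by positivity), Real.log_mul (by positivity) (by positivity),
      Real.log_div (by positivity) (by positivity), Real.log_pow, Real.log_pow, Real.log_pow]
    push_cast
    ring
  have i1' : Integrable (fun p : ℝ × ℝ => Real.log (1 - p.1)) P := i1
  have i2' : Integrable (fun p : ℝ × ℝ => Real.log p.2) P := i2
  have j1 : Integrable (fun p : ℝ × ℝ =>
      Real.log (((k : ℝ) + 1) / (k + 2)) + k * Real.log (p.2 - p.1)) P :=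
    (integrable_const _).add i3
  have j2 : Integrable (fun p : ℝ × ℝ =>
      ((k : ℝ) + 1) * (Real.log (1 - p.1) + Real.log p.2)) P := (i1'.add i2').const_mul _
  rw [klDiv, if_pos hac, integral_congr_ae hlog, integral_sub j1 j2,
    integral_add (integrable_const _) i3, v3, integral_const_mul, integral_add i1' i2', v1, v2]
  congr 1
  simp only [integral_const, probReal_univ, one_smul]
  push_cast
  rw [show (k : ℝ) + 2 - 1 = k + 1 by ring]
  field_simp
  ring
end
end

section
/- For every integer k ≥ 1, the quantity e(k) := k·log(2k/(2k+1)) + (1/2)·log(2πk) − (1+γ)·k − T_k satisfies k/(24(k+1)²) − 1/(12k) ≤ e(k) ≤ 1/(24k) − 1/(12k+1). -/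
open MeasureTheory Real Filter Topology Classical

noncomputable section

lemma aux_log_lower (x : ℝ) (h0 : 0 < x) (h1 : x < 1) :
    2 * x + 2 * x ^ 3 / 3 ≤ Real.log (1 + x) - Real.log (1 - x) := by
  have h := Real.hasSum_log_sub_log_of_abs_lt_one (x := x) (by rw [abs_of_pos h0]; exact h1)
  have := sum_le_hasSum (Finset.range 2) (fun i _ => by positivity) h
  simp only [Finset.sum_range_succ, Finset.sum_range_zero] at this
  norm_num at this
  linarith

lemma aux_log_upper (x : ℝ) (h0 : 0 < x) (h1 : x < 1) :
    Real.log (1 + x) - Real.log (1 - x) ≤ 2 * x + 2 * x ^ 3 / (3 * (1 - x ^ 2)) := by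
  have h := Real.hasSum_log_sub_log_of_abs_lt_one (x := x) (by rw [abs_of_pos h0]; exact h1)
  have h2 := (hasSum_nat_add_iff' 1).mpr h
  have hx2 : x ^ 2 < 1 := by nlinarith
  have hg := (hasSum_geometric_of_lt_one (sq_nonneg x) hx2).mul_left (2 * x ^ 3 / 3)
  have := hasSum_le (fun n => ?_) h2 hg
  · simp only [Finset.sum_range_succ, Finset.sum_range_zero] at this
    norm_num at this
    have e : 2 * x ^ 3 / (3 * (1 - x ^ 2)) = 2 * x ^ 3 / 3 * (1 - x ^ 2)⁻¹ := by
      have : (1 - x ^ 2) ≠ 0 := by linarith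
      field_simp
    rw [e]; linarith
  · have e : 2 * x ^ 3 / 3 * (x ^ 2) ^ n = 2 * (1 / 3) * x ^ (2 * (n + 1) + 1) := by
      rw [← pow_mul]; ring
    rw [e]
    have : (1 : ℝ) / (2 * ((n + 1 : ℕ) : ℝ) + 1) ≤ 1 / 3 := by
      apply one_div_le_one_div_of_le (by norm_num)
      push_cast
      have : (0 : ℝ) ≤ n := Nat.cast_nonneg n
      linarith
    gcongr

lemma aux_tel (F : ℕ → ℝ) (L : ℝ) (hL : Tendsto F atTop (𝓝 L))
    (hF : ∀ n : ℕ, 1 ≤ n → F (n + 1) ≤ F n) (k : ℕ) (hk : 1 ≤ k) : L ≤ F k := by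
  have ha : Antitone (fun n => F (n + 1)) :=
    antitone_nat_of_succ_le (fun n => hF (n + 1) (by omega))
  have := ha.le_of_tendsto ((tendsto_add_atTop_iff_nat 1).mpr hL) (k - 1)
  simpa [Nat.sub_add_cancel hk] using this

/-- Stirling deviation. -/
def aSeq (n : ℕ) : ℝ := Real.log (Stirling.stirlingSeq n) - Real.log (√π)

/-- DeTemple sequence. -/
def bSeq (n : ℕ) : ℝ := (harmonic n : ℝ) - Real.log ((n : ℝ) + 1 / 2)

lemma aSeq_tendsto : Tendsto aSeq atTop (𝓝 0) := by
  have h := (Stirling.tendsto_stirlingSeq_sqrt_pi.log (by positivity)).sub_const (Real.log (√π))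
  rw [sub_self] at h
  exact h

lemma bSeq_tendsto : Tendsto bSeq atTop (𝓝 Real.eulerMascheroniConstant) := by
  refine tendsto_of_tendsto_of_tendsto_of_le_of_le' Real.tendsto_harmonic_sub_log_add_one
    Real.tendsto_harmonic_sub_log ?_ ?_
  · filter_upwards with n
    unfold bSeq
    have : Real.log ((n : ℝ) + 1 / 2) ≤ Real.log ((n : ℝ) + 1) :=
      Real.log_le_log (by positivity) (by linarith)
    linarith
  · filter_upwards [eventually_ge_atTop 1] with n hn
    unfold bSeq
    have hn' : (1 : ℝ) ≤ n := by exact_mod_cast hn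
    have : Real.log (n : ℝ) ≤ Real.log ((n : ℝ) + 1 / 2) :=
      Real.log_le_log (by positivity) (by linarith)
    linarith

lemma aSeq_eq (n : ℕ) (hn : 1 ≤ n) : aSeq n =
    Real.log (n.factorial) - (1 / 2) * Real.log (2 * π * n) - n * Real.log n + n := by
  have hn' : (0 : ℝ) < n := by exact_mod_cast hn
  unfold aSeq
  rw [Stirling.log_stirlingSeq_formula, Real.log_sqrt pi_pos.le,
    Real.log_div hn'.ne' (Real.exp_pos 1).ne', Real.log_exp,
    Real.log_mul (by norm_num) hn'.ne', Real.log_mul (by positivity) hn'.ne',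
    Real.log_mul (by norm_num) pi_pos.ne']
  ring

lemma aSeq_diff (n : ℕ) (hn : 1 ≤ n) : aSeq n - aSeq (n + 1) =
    ((n : ℝ) + 1 / 2) *
      (Real.log (1 + 1 / (2 * n + 1)) - Real.log (1 - 1 / (2 * n + 1))) - 1 := by
  have hn' : (0 : ℝ) < n := by exact_mod_cast hn
  have e1 : (1 : ℝ) + 1 / (2 * n + 1) = 2 * (n + 1) / (2 * n + 1) := by field_simp; ring
  have e2 : (1 : ℝ) - 1 / (2 * n + 1) = 2 * n / (2 * n + 1) := by field_simp; ring
  rw [aSeq_eq n hn, aSeq_eq (n + 1) (by omega), e1, e2, Nat.factorial_succ]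
  push_cast
  have hf : (0 : ℝ) < n.factorial := by exact_mod_cast n.factorial_pos
  rw [Real.log_div (by positivity) (by positivity), Real.log_div (by positivity) (by positivity),
    Real.log_mul (by positivity) hf.ne', Real.log_mul (by positivity) hn'.ne',
    Real.log_mul (x := 2 * π) (by positivity) (by positivity),
    Real.log_mul (x := 2) (y := (n : ℝ) + 1) (by positivity) (by positivity),
    Real.log_mul (x := 2) (y := (n : ℝ)) (by positivity) (by positivity)]
  ring

lemma bSeq_diff (n : ℕ) : bSeq n - bSeq (n + 1) =
    Real.log (1 + 1 / (2 * (n + 1))) - Real.log (1 - 1 / (2 * (n + 1))) - 1 / ((n : ℝ) + 1) := by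
  have hn' : (0 : ℝ) ≤ n := Nat.cast_nonneg n
  have e1 : (1 : ℝ) + 1 / (2 * (n + 1)) = (n + 1 + 1 / 2) / (n + 1) := by field_simp
  have e2 : (1 : ℝ) - 1 / (2 * (n + 1)) = (n + 1 / 2) / (n + 1) := by field_simp; ring
  rw [e1, e2, Real.log_div (by positivity) (by positivity),
    Real.log_div (by positivity) (by positivity)]
  unfold bSeq
  rw [harmonic_succ]
  push_cast
  ring

lemma aSeq_lower (k : ℕ) (hk : 1 ≤ k) : 1 / (12 * (k : ℝ) + 1) ≤ aSeq k := by
  have hlim : Tendsto (fun n : ℕ => 1 / (12 * (n : ℝ) + 1)) atTop (𝓝 0) := by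
    refine tendsto_const_nhds.div_atTop (tendsto_atTop_add_const_right _ _ ?_)
    exact tendsto_natCast_atTop_atTop.const_mul_atTop (by norm_num)
  have := aux_tel (fun n => aSeq n - 1 / (12 * (n : ℝ) + 1)) 0
    (by simpa using aSeq_tendsto.sub hlim) (fun n hn => ?_) k hk
  · linarith
  have hn' : (1 : ℝ) ≤ n := by exact_mod_cast hn
  have h := aSeq_diff n hn
  have h2 := aux_log_lower (1 / (2 * n + 1)) (by positivity)
    (by rw [div_lt_one (by positivity)]; linarith)
  have h3 := mul_le_mul_of_nonneg_left h2 (show (0 : ℝ) ≤ n + 1 / 2 by positivity)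
  have e : ((n : ℝ) + 1 / 2) * (2 * (1 / (2 * n + 1)) + 2 * (1 / (2 * n + 1)) ^ 3 / 3)
      = 1 + 1 / (3 * (2 * n + 1) ^ 2) := by
    field_simp
  have h4 : 1 / (12 * (n : ℝ) + 1) - 1 / (12 * (n + 1 : ℝ) + 1) ≤ 1 / (3 * (2 * n + 1) ^ 2) := by
    rw [div_sub_div _ _ (by positivity) (by positivity),
      div_le_div_iff₀ (by positivity) (by positivity)]
    nlinarith
  push_cast
  linarith

lemma aSeq_upper (k : ℕ) (hk : 1 ≤ k) : aSeq k ≤ 1 / (12 * (k : ℝ)) := by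
  have hlim : Tendsto (fun n : ℕ => 1 / (12 * (n : ℝ))) atTop (𝓝 0) := by
    refine tendsto_const_nhds.div_atTop ?_
    exact tendsto_natCast_atTop_atTop.const_mul_atTop (by norm_num)
  have := aux_tel (fun n => 1 / (12 * (n : ℝ)) - aSeq n) 0
    (by simpa using hlim.sub aSeq_tendsto) (fun n hn => ?_) k hk
  · linarith
  have hn' : (1 : ℝ) ≤ n := by exact_mod_cast hn
  have h := aSeq_diff n hn
  have h2 := aux_log_upper (1 / (2 * n + 1)) (by positivity)
    (by rw [div_lt_one (by positivity)]; linarith)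
  have h3 := mul_le_mul_of_nonneg_left h2 (show (0 : ℝ) ≤ n + 1 / 2 by positivity)
  have e0 : (1 : ℝ) - (1 / (2 * n + 1)) ^ 2 = 4 * n * (n + 1) / (2 * n + 1) ^ 2 := by
    field_simp
    ring
  have e : ((n : ℝ) + 1 / 2) * (2 * (1 / (2 * n + 1)) +
      2 * (1 / (2 * n + 1)) ^ 3 / (3 * (1 - (1 / (2 * n + 1)) ^ 2)))
      = 1 + (1 / (12 * n) - 1 / (12 * (n + 1))) := by
    rw [e0]
    field_simp
    ring
  push_cast
  linarith

lemma bSeq_lower (k : ℕ) (hk : 1 ≤ k) :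
    Real.eulerMascheroniConstant + 1 / (24 * ((k : ℝ) + 1) ^ 2) ≤ bSeq k := by
  have hlim : Tendsto (fun n : ℕ => 1 / (24 * ((n : ℝ) + 1) ^ 2)) atTop (𝓝 0) := by
    refine tendsto_const_nhds.div_atTop (Tendsto.const_mul_atTop (by norm_num) ?_)
    exact (tendsto_pow_atTop (by norm_num)).comp
      (tendsto_atTop_add_const_right _ _ tendsto_natCast_atTop_atTop)
  have := aux_tel (fun n => bSeq n - 1 / (24 * ((n : ℝ) + 1) ^ 2)) Real.eulerMascheroniConstant
    (by simpa using bSeq_tendsto.sub hlim) (fun n hn => ?_) k hk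
  · linarith
  have hn' : (1 : ℝ) ≤ n := by exact_mod_cast hn
  have h := bSeq_diff n
  have h2 := aux_log_lower (1 / (2 * (n + 1))) (by positivity)
    (by rw [div_lt_one (by positivity)]; linarith)
  have e : 2 * (1 / (2 * ((n : ℝ) + 1))) + 2 * (1 / (2 * (n + 1))) ^ 3 / 3
      = 1 / (n + 1) + 1 / (12 * (n + 1) ^ 3) := by
    field_simp
    ring
  have h4 : 1 / (24 * ((n : ℝ) + 1) ^ 2) - 1 / (24 * ((n : ℝ) + 1 + 1) ^ 2)
      ≤ 1 / (12 * (n + 1) ^ 3) := by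
    rw [← sub_nonneg]
    have : 1 / (12 * ((n : ℝ) + 1) ^ 3)
      - (1 / (24 * ((n : ℝ) + 1) ^ 2) - 1 / (24 * ((n : ℝ) + 1 + 1) ^ 2))
      = (3 * (n + 1) + 2) / (24 * (n + 1) ^ 3 * (n + 1 + 1) ^ 2) := by
      field_simp
      ring
    rw [this]; positivity
  push_cast
  linarith

lemma bSeq_upper (k : ℕ) (hk : 1 ≤ k) :
    bSeq k ≤ Real.eulerMascheroniConstant + 1 / (24 * (k : ℝ) ^ 2) := by
  have hlim : Tendsto (fun n : ℕ => 1 / (24 * (n : ℝ) ^ 2)) atTop (𝓝 0) := by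
    refine tendsto_const_nhds.div_atTop (Tendsto.const_mul_atTop (by norm_num) ?_)
    exact (tendsto_pow_atTop (by norm_num)).comp tendsto_natCast_atTop_atTop
  have := aux_tel (fun n => 1 / (24 * (n : ℝ) ^ 2) - bSeq n) (-Real.eulerMascheroniConstant)
    (by simpa using hlim.sub bSeq_tendsto) (fun n hn => ?_) k hk
  · linarith
  have hn' : (1 : ℝ) ≤ n := by exact_mod_cast hn
  have h := bSeq_diff n
  have h2 := aux_log_upper (1 / (2 * (n + 1))) (by positivity)
    (by rw [div_lt_one (by positivity)]; linarith)
  have e0 : (1 : ℝ) - (1 / (2 * (n + 1))) ^ 2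
      = (2 * n + 1) * (2 * n + 3) / (2 * (n + 1)) ^ 2 := by
    field_simp
    ring
  have e : 2 * (1 / (2 * ((n : ℝ) + 1))) +
      2 * (1 / (2 * (n + 1))) ^ 3 / (3 * (1 - (1 / (2 * (n + 1))) ^ 2))
      = 1 / (n + 1) + 1 / (3 * (n + 1) * (2 * n + 1) * (2 * n + 3)) := by
    rw [e0]
    field_simp
  have h4 : 1 / (3 * ((n : ℝ) + 1) * (2 * n + 1) * (2 * n + 3))
      ≤ 1 / (24 * (n : ℝ) ^ 2) - 1 / (24 * ((n : ℝ) + 1) ^ 2) := by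
    rw [← sub_nonneg]
    have : 1 / (24 * (n : ℝ) ^ 2) - 1 / (24 * ((n : ℝ) + 1) ^ 2)
      - 1 / (3 * ((n : ℝ) + 1) * (2 * n + 1) * (2 * n + 3))
      = (12 * n ^ 2 + 14 * n + 3) / (24 * n ^ 2 * (n + 1) ^ 2 * (2 * n + 1) * (2 * n + 3)) := by
      field_simp
      ring
    rw [this]; positivity
  push_cast
  linarith

lemma e_eq (k : ℕ) (hk : 1 ≤ k) :
    (k : ℝ) * Real.log (2 * k / (2 * k + 1)) + (1 / 2) * Real.log (2 * Real.pi * k)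
          - (1 + Real.eulerMascheroniConstant) * k - T k
      = k * (bSeq k - Real.eulerMascheroniConstant) - aSeq k := by
  have hn' : (0 : ℝ) < k := by exact_mod_cast hk
  have e : (2 * (k : ℝ) / (2 * k + 1)) = k / (k + 1 / 2) := by field_simp
  rw [aSeq_eq k hk, e, Real.log_div (by positivity) (by positivity)]
  unfold bSeq T
  ring

/-- Bounds on `e(k) = k log(2k/(2k+1)) + (1/2) log(2πk) - (1+γ) k - T_k`. -/
theorem e_bounds (k : ℕ) (hk : 1 ≤ k) :
    (k : ℝ) / (24 * ((k : ℝ) + 1) ^ 2) - 1 / (12 * k) ≤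
        (k : ℝ) * Real.log (2 * k / (2 * k + 1)) + (1 / 2) * Real.log (2 * Real.pi * k)
          - (1 + Real.eulerMascheroniConstant) * k - T k ∧
      (k : ℝ) * Real.log (2 * k / (2 * k + 1)) + (1 / 2) * Real.log (2 * Real.pi * k)
          - (1 + Real.eulerMascheroniConstant) * k - T k ≤
        1 / (24 * k) - 1 / (12 * k + 1) := by
  rw [e_eq k hk]
  have hn' : (0 : ℝ) < k := by exact_mod_cast hk
  have a1 := aSeq_lower k hk
  have a2 := aSeq_upper k hk
  have b1 := mul_le_mul_of_nonneg_left (bSeq_lower k hk) hn'.le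
  have b2 := mul_le_mul_of_nonneg_left (bSeq_upper k hk) hn'.le
  have e1 : (k : ℝ) * (1 / (24 * ((k : ℝ) + 1) ^ 2)) = k / (24 * ((k : ℝ) + 1) ^ 2) := by ring
  have e2 : (k : ℝ) * (1 / (24 * (k : ℝ) ^ 2)) = 1 / (24 * k) := by field_simp
  rw [mul_add] at b1 b2
  constructor
  · rw [mul_sub]; linarith
  · rw [mul_sub]; linarith
end
end

section
/- For every integer k ≥ 1, the quantity c(k) := log((2k+2)/(2k+3)) − (1+γ) + 1/(k+1) − (T_{k+1} − T_k) satisfies 1/(24(k+2)²) ≤ c(k) ≤ 1/(24(k+1)²). -/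
open MeasureTheory Real Filter Topology Classical

noncomputable section

lemma log_lower {x : ℝ} (h0 : 0 ≤ x) (h1 : x < 1) :
    2 * x + 2 / 3 * x ^ 3 ≤ Real.log (1 + x) - Real.log (1 - x) := by
  have h := hasSum_log_sub_log_of_abs_lt_one (x := x) (by rw [abs_lt]; constructor <;> linarith)
  have := sum_le_hasSum (Finset.range 2) (fun i _ => by positivity) h
  simp only [Finset.sum_range_succ, Finset.sum_range_zero] at this
  norm_num at this
  linarith

lemma log_upper {x : ℝ} (h0 : 0 ≤ x) (h1 : x < 1) :
    Real.log (1 + x) - Real.log (1 - x) ≤ 4 / 3 * x + 2 / 3 * x * (1 - x ^ 2)⁻¹ := by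
  have h := hasSum_log_sub_log_of_abs_lt_one (x := x) (by rw [abs_lt]; constructor <;> linarith)
  have hg := (hasSum_geometric_of_lt_one (r := x ^ 2) (by positivity) (by nlinarith)).mul_left
    (2 / 3 * x)
  have hs := (hasSum_ite_eq (0 : ℕ) (4 / 3 * x)).add hg
  refine hasSum_le (fun i => ?_) h hs
  rcases Nat.eq_zero_or_pos i with rfl | hi
  · norm_num; linarith
  · have hp : 0 ≤ x ^ (2 * i + 1) := by positivity
    have he : 2 / 3 * x * (x ^ 2) ^ i = 2 / 3 * x ^ (2 * i + 1) := by
      rw [← pow_mul]; ring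
    have hi' : (1 : ℝ) ≤ i := by exact_mod_cast hi
    have hq : 2 * (1 / (2 * (i : ℝ) + 1)) ≤ 2 / 3 := by
      rw [mul_one_div, div_le_div_iff₀ (by positivity) (by norm_num)]; linarith
    simp only [he, hi.ne', if_false, zero_add]
    exact mul_le_mul_of_nonneg_right hq hp

lemma log_step (m : ℝ) (hm : 2 ≤ m) :
    Real.log (m + 1 / 2) - Real.log (m - 1 / 2) =
      Real.log (1 + 1 / (2 * m)) - Real.log (1 - 1 / (2 * m)) := by
  have h1 : 1 + 1 / (2 * m) = (m + 1 / 2) / m := by field_simp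
  have h2 : 1 - 1 / (2 * m) = (m - 1 / 2) / m := by field_simp
  rw [h1, h2, Real.log_div (by linarith) (by linarith), Real.log_div (by linarith) (by linarith)]
  ring

lemma step_lower (m : ℝ) (hm : 2 ≤ m) :
    1 / m + (1 / (24 * m ^ 2) - 1 / (24 * (m + 1) ^ 2)) ≤
      Real.log (m + 1 / 2) - Real.log (m - 1 / 2) := by
  have hm0 : 0 < m := by linarith
  rw [log_step m hm]
  refine le_trans ?_ (log_lower (by positivity) (by rw [div_lt_one] <;> linarith))
  rw [← sub_nonneg]
  have : 2 * (1 / (2 * m)) + 2 / 3 * (1 / (2 * m)) ^ 3 -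
      (1 / m + (1 / (24 * m ^ 2) - 1 / (24 * (m + 1) ^ 2))) =
      (3 * m + 2) / (24 * m ^ 3 * (m + 1) ^ 2) := by
    field_simp; ring
  rw [this]; positivity

lemma step_upper (m : ℝ) (hm : 2 ≤ m) :
    Real.log (m + 1 / 2) - Real.log (m - 1 / 2) ≤
      1 / m + (1 / (24 * (m - 1) ^ 2) - 1 / (24 * m ^ 2)) := by
  have hm0 : 0 < m := by linarith
  rw [log_step m hm]
  refine le_trans (log_upper (by positivity) (by rw [div_lt_one] <;> linarith)) ?_
  rw [← sub_nonneg]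
  have h1 : 0 < m - 1 := by linarith
  have h2 : 0 < 4 * m ^ 2 - 1 := by nlinarith
  have h3 : (1 - (1 / (2 * m)) ^ 2)⁻¹ = 4 * m ^ 2 / (4 * m ^ 2 - 1) := by
    rw [← inv_div]; congr 1; field_simp; ring
  rw [h3]
  have : 1 / m + (1 / (24 * (m - 1) ^ 2) - 1 / (24 * m ^ 2)) -
      (4 / 3 * (1 / (2 * m)) + 2 / 3 * (1 / (2 * m)) * (4 * m ^ 2 / (4 * m ^ 2 - 1))) =
      (12 * m ^ 2 - 10 * m + 1) / (24 * m ^ 2 * (m - 1) ^ 2 * (4 * m ^ 2 - 1) ) := by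
    have h1' := h1.ne'
    obtain ⟨q, hq⟩ : ∃ q, q = 4 * m ^ 2 - 1 := ⟨_, rfl⟩
    rw [← hq] at h2 ⊢
    have h2' := h2.ne'
    field_simp
    rw [hq]
    ring
  rw [this]
  have : 0 < 12 * m ^ 2 - 10 * m + 1 := by nlinarith
  positivity

def dSeq (n : ℕ) : ℝ := (harmonic (n + 1) : ℝ) - Real.log ((n : ℝ) + 3 / 2)

lemma dSeq_succ (n : ℕ) : dSeq n - dSeq (n + 1) =
    Real.log (((n : ℝ) + 2) + 1 / 2) - Real.log (((n : ℝ) + 2) - 1 / 2) - 1 / ((n : ℝ) + 2) := by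
  unfold dSeq
  rw [harmonic_succ (n + 1)]
  push_cast
  rw [show (n : ℝ) + 1 + 3 / 2 = n + 2 + 1 / 2 by ring,
    show (n : ℝ) + 3 / 2 = n + 2 - 1 / 2 by ring, show (n : ℝ) + 1 + 1 = n + 2 by ring]
  ring

lemma tendsto_aux (a b : ℝ) (ha : 0 < a) (hb : 0 < b) :
    Tendsto (fun n : ℕ => 1 / (a * ((n : ℝ) + b) ^ 2)) atTop (𝓝 0) := by
  have h : Tendsto (fun n : ℕ => (n : ℝ) + b) atTop atTop :=
    tendsto_atTop_add_const_right _ _ tendsto_natCast_atTop_atTop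
  have h2 := ((tendsto_pow_atTop (two_ne_zero)).comp h).const_mul_atTop ha
  refine h2.inv_tendsto_atTop.congr fun n => ?_
  simp

lemma tendsto_dSeq : Tendsto dSeq atTop (𝓝 Real.eulerMascheroniConstant) := by
  have h1 := (tendsto_add_atTop_iff_nat 1).2 Real.tendsto_harmonic_sub_log
  have h : Tendsto (fun n : ℕ => (n : ℝ) + 1) atTop atTop :=
    tendsto_atTop_add_const_right _ _ tendsto_natCast_atTop_atTop
  have h2 : Tendsto (fun n : ℕ => Real.log (1 + (1 / 2) * ((n : ℝ) + 1)⁻¹)) atTop (𝓝 0) := by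
    have := ((h.inv_tendsto_atTop.const_mul (1 / 2 : ℝ)).const_add 1).log (by norm_num)
    simpa using this
  have h3 := h1.sub h2
  rw [sub_zero] at h3
  refine h3.congr fun n => ?_
  unfold dSeq
  have hn : (0 : ℝ) < (n : ℝ) + 1 := by positivity
  rw [show (n : ℝ) + 3 / 2 = (n + 1) * (1 + (1 / 2) * ((n : ℝ) + 1)⁻¹) by field_simp; ring,
    Real.log_mul hn.ne' (by positivity)]
  push_cast
  ring

lemma dSeq_upper (n : ℕ) :
    dSeq n - 1 / (24 * ((n : ℝ) + 1) ^ 2) ≤ Real.eulerMascheroniConstant := by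
  have hm : Monotone fun n : ℕ => dSeq n - 1 / (24 * ((n : ℝ) + 1) ^ 2) := by
    refine monotone_nat_of_le_succ fun n => ?_
    have := step_upper ((n : ℝ) + 2) (by linarith [(Nat.cast_nonneg n : (0 : ℝ) ≤ n)])
    have h2 := dSeq_succ n
    push_cast
    rw [show (n : ℝ) + 2 - 1 = n + 1 by ring] at this
    rw [show (n : ℝ) + 1 + 1 = n + 2 by ring]
    linarith
  have ht := tendsto_dSeq.sub (tendsto_aux 24 1 (by norm_num) (by norm_num))
  rw [sub_zero] at ht
  exact hm.ge_of_tendsto ht n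

lemma dSeq_lower (n : ℕ) :
    Real.eulerMascheroniConstant ≤ dSeq n - 1 / (24 * ((n : ℝ) + 2) ^ 2) := by
  have hm : Antitone fun n : ℕ => dSeq n - 1 / (24 * ((n : ℝ) + 2) ^ 2) := by
    refine antitone_nat_of_succ_le fun n => ?_
    have := step_lower ((n : ℝ) + 2) (by linarith [(Nat.cast_nonneg n : (0 : ℝ) ≤ n)])
    have h2 := dSeq_succ n
    push_cast
    rw [show (n : ℝ) + 1 + 2 = n + 2 + 1 by ring]
    linarith
  have ht := tendsto_dSeq.sub (tendsto_aux 24 2 (by norm_num) (by norm_num))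
  rw [sub_zero] at ht
  exact hm.le_of_tendsto ht n

lemma c_eq (k : ℕ) : Real.log ((2 * (k : ℝ) + 2) / (2 * k + 3)) -
    (1 + Real.eulerMascheroniConstant) + 1 / ((k : ℝ) + 1) - (T (k + 1) - T k) =
    dSeq k - Real.eulerMascheroniConstant := by
  have hk : (0 : ℝ) < (k : ℝ) + 1 := by positivity
  have hf : (0 : ℝ) < (Nat.factorial k : ℝ) := by exact_mod_cast Nat.factorial_pos k
  have h1 : (2 * (k : ℝ) + 2) / (2 * k + 3) = (k + 1) / (k + 3 / 2) := by
    field_simp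
  unfold T dSeq
  rw [h1, Real.log_div hk.ne' (by positivity), Nat.factorial_succ, harmonic_succ]
  push_cast
  rw [Real.log_mul hk.ne' hf.ne']
  field_simp
  ring

/-- Bounds on `c(k) = log((2k+2)/(2k+3)) - (1+γ) + 1/(k+1) - (T_(k+1) - T_k)`. -/
theorem c_bounds (k : ℕ) (hk : 1 ≤ k) :
    1 / (24 * ((k : ℝ) + 2) ^ 2) ≤
        Real.log ((2 * (k : ℝ) + 2) / (2 * k + 3)) - (1 + Real.eulerMascheroniConstant)
          + 1 / ((k : ℝ) + 1) - (T (k + 1) - T k) ∧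
      Real.log ((2 * (k : ℝ) + 2) / (2 * k + 3)) - (1 + Real.eulerMascheroniConstant)
          + 1 / ((k : ℝ) + 1) - (T (k + 1) - T k) ≤
        1 / (24 * ((k : ℝ) + 1) ^ 2) := by
  rw [c_eq]
  constructor
  · linarith [dSeq_lower k]
  · linarith [dSeq_upper k]
end
end

section
/- Fix real numbers 0 < α < β < 1. Then the sequence T_{⌈βn⌉−1} + T_{n−⌊αn⌋} − T_{⌈βn⌉−⌊αn⌋−1} − T_n converges, as n → ∞, to (1/2)·log(β(1−α)/(β−α)). Equivalently, for an i.i.d. sample from any distribution with invertible cdf, lim_{n→∞} I(X_(⌊αn⌋); X_(⌈βn⌉)) = (1/2)·log(β(1−α)/(β−α)), since I(X_(⌊αn⌋); X_(⌈βn⌉)) = T_{⌈βn⌉−1} + T_{n−⌊αn⌋} − T_{⌈βn⌉−⌊αn⌋−1} − T_n. -/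
open MeasureTheory Real Filter Topology Classical

noncomputable section

theorem aux_harm (n : ℕ) (hn : 1 ≤ n) :
    1 / (2 * ((n:ℝ) + 1)) ≤ (harmonic n : ℝ) - Real.log n - eulerMascheroniConstant ∧
    (harmonic n : ℝ) - Real.log n - eulerMascheroniConstant ≤ 1 / (2 * (n:ℝ)) := by
  have key : ∀ k : ℕ, 1 ≤ k → Real.log ((k+1 : ℕ):ℝ) - Real.log k = Real.log (1 + 1/(k:ℝ)) := by
    intro k hk
    have hk' : (0:ℝ) < k := by exact_mod_cast hk
    rw [← Real.log_div (by positivity) (by positivity)]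
    congr 1
    push_cast
    field_simp
  have hlow : ∀ k : ℕ, 1 ≤ k → 2 / (2 * (k:ℝ) + 1) ≤ Real.log (1 + 1/(k:ℝ)) := by
    intro k hk
    have hk' : (0:ℝ) < k := by exact_mod_cast hk
    have := Real.le_log_one_add_of_nonneg (x := 1/(k:ℝ)) (by positivity)
    refine le_trans (le_of_eq ?_) this
    field_simp
    try ring
  have hup : ∀ k : ℕ, 1 ≤ k →
      Real.log (1 + 1/(k:ℝ)) ≤ (2 * (k:ℝ) + 1) / (2 * k * (k + 1)) := by
    intro k hk
    have hk' : (0:ℝ) < k := by exact_mod_cast hk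
    have h0 : (0:ℝ) ≤ Real.log (1 + 1/(k:ℝ)) := Real.log_nonneg (by
      have : (0:ℝ) < 1/(k:ℝ) := by positivity
      linarith)
    have := Real.self_le_sinh_iff.2 h0
    rw [Real.sinh_log (by positivity)] at this
    refine le_trans this (le_of_eq ?_)
    field_simp
    ring
  have hinv : ∀ c : ℕ, Tendsto (fun k : ℕ => 1 / (2 * ((k:ℝ) + c))) atTop (𝓝 0) := by
    intro c
    have h1 : Tendsto (fun k : ℕ => 2 * ((k:ℝ) + c)) atTop atTop :=
      (tendsto_atTop_add_const_right _ _ tendsto_natCast_atTop_atTop).const_mul_atTop (by norm_num)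
    exact h1.inv_tendsto_atTop.congr (fun k => by simp only [Pi.inv_apply, one_div])
  have hd : Tendsto (fun k : ℕ => (harmonic k : ℝ) - Real.log k - eulerMascheroniConstant)
      atTop (𝓝 0) := by
    have := Real.tendsto_harmonic_sub_log.sub_const eulerMascheroniConstant
    simpa using this
  constructor
  · have hanti : AntitoneOn (fun k : ℕ => (harmonic k : ℝ) - Real.log k - eulerMascheroniConstant
        - 1 / (2 * ((k:ℝ) + 1))) (Set.Ici 1) := by
      refine antitoneOn_nat_Ici_of_succ_le ?_
      intro k hk
      have hk' : (0:ℝ) < k := by exact_mod_cast hk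
      have h1 := key k hk
      have h2 := hlow k hk
      rw [harmonic_succ]
      push_cast at h1 ⊢
      have h3 : ((k:ℝ)+1)⁻¹ + 1 / (2 * ((k:ℝ)+1)) - 1 / (2 * ((k:ℝ) + 1 + 1)) ≤ 2 / (2 * (k:ℝ) + 1) := by
        rw [← sub_nonneg]
        have : 2 / (2 * (k:ℝ) + 1) - (((k:ℝ)+1)⁻¹ + 1 / (2 * ((k:ℝ)+1)) - 1 / (2 * ((k:ℝ) + 1 + 1)))
          = 3 / (2 * (k+1) * (k+2) * (2 * k + 1)) := by
          field_simp
          ring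
        rw [this]; positivity
      linarith
    have hlim := hd.sub (hinv 1)
    simp only [sub_zero, Nat.cast_one] at hlim
    have := le_of_tendsto hlim (by
      filter_upwards [eventually_ge_atTop n] with m hm
      exact hanti (Set.mem_Ici.2 hn) (Set.mem_Ici.2 (hn.trans hm)) hm)
    linarith
  · have hmono : MonotoneOn (fun k : ℕ => (harmonic k : ℝ) - Real.log k - eulerMascheroniConstant
        - 1 / (2 * (k:ℝ))) (Set.Ici 1) := by
      refine monotoneOn_nat_Ici_of_le_succ ?_
      intro k hk
      have hk' : (0:ℝ) < k := by exact_mod_cast hk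
      have h1 := key k hk
      have h2 := hup k hk
      rw [harmonic_succ]
      push_cast at h1 ⊢
      have h3 : (2 * (k:ℝ) + 1) / (2 * k * (k + 1)) = ((k:ℝ)+1)⁻¹ + 1 / (2 * (k:ℝ)) - 1 / (2 * ((k:ℝ) + 1)) := by
        field_simp
        ring
      linarith
    have hlim := hd.sub (hinv 0)
    simp only [sub_zero, Nat.cast_zero, add_zero] at hlim
    have := ge_of_tendsto hlim (by
      filter_upwards [eventually_ge_atTop n] with m hm
      exact hmono (Set.mem_Ici.2 hn) (Set.mem_Ici.2 (hn.trans hm)) hm)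
    linarith

theorem aux_nharm : Tendsto (fun n : ℕ => (n:ℝ) * ((harmonic n : ℝ) - Real.log n - eulerMascheroniConstant))
    atTop (𝓝 (1/2)) := by
  have h1 : Tendsto (fun n : ℕ => (1/2:ℝ) * ((n:ℝ) / ((n:ℝ) + 1))) atTop (𝓝 (1/2)) := by
    simpa using (tendsto_natCast_div_add_atTop (1:ℝ)).const_mul (1/2:ℝ)
  refine tendsto_of_tendsto_of_tendsto_of_le_of_le' h1 tendsto_const_nhds ?_ ?_
  · filter_upwards [eventually_ge_atTop 1] with n hn
    have hn' : (0:ℝ) < n := by exact_mod_cast hn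
    have := mul_le_mul_of_nonneg_left (aux_harm n hn).1 hn'.le
    refine le_trans (le_of_eq ?_) this
    field_simp
  · filter_upwards [eventually_ge_atTop 1] with n hn
    have hn' : (0:ℝ) < n := by exact_mod_cast hn
    have := mul_le_mul_of_nonneg_left (aux_harm n hn).2 hn'.le
    refine le_trans this (le_of_eq ?_)
    field_simp

theorem aux_T : ∃ c : ℝ, Tendsto (fun n : ℕ => T n + (1 + eulerMascheroniConstant) * n
    - (1/2) * Real.log n) atTop (𝓝 c) := by
  have hs : Tendsto (fun n => Real.log (Stirling.stirlingSeq n)) atTop (𝓝 (Real.log (√π))) :=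
    Stirling.tendsto_stirlingSeq_sqrt_pi.log (by positivity)
  refine ⟨_, ((hs.add_const ((1/2) * Real.log 2)).sub aux_nharm).congr' ?_⟩
  filter_upwards [eventually_ge_atTop 1] with n hn
  have hn' : (0:ℝ) < n := by exact_mod_cast hn
  rw [Stirling.log_stirlingSeq_formula, T, Real.log_div hn'.ne' (Real.exp_pos 1).ne', Real.log_exp,
    Real.log_mul (by norm_num) hn'.ne']
  ring

/-- `⌊αn⌋` vs `⌈βn⌉`: for fixed `0 < α < β < 1`,
`T_(⌈βn⌉-1) + T_(n-⌊αn⌋) - T_(⌈βn⌉-⌊αn⌋-1) - T_n → (1/2) log (β(1-α)/(β-α))`. -/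
theorem tendsto_mi_alpha_beta (α β : ℝ) (hα : 0 < α) (hαβ : α < β) (hβ : β < 1) :
    Tendsto (fun n : ℕ =>
        T (⌈β * n⌉₊ - 1) + T (n - ⌊α * n⌋₊) - T (⌈β * n⌉₊ - ⌊α * n⌋₊ - 1) - T n)
      atTop (𝓝 ((1 / 2) * Real.log (β * (1 - α) / (β - α)))) := by
  obtain ⟨c, hc⟩ := aux_T
  have hN : Tendsto (fun n : ℕ => (n:ℝ)) atTop atTop := tendsto_natCast_atTop_atTop
  have ha : Tendsto (fun n : ℕ => (⌊α * n⌋₊ : ℝ) / n) atTop (𝓝 α) :=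
    (tendsto_nat_floor_mul_div_atTop hα.le).comp hN
  have hb : Tendsto (fun n : ℕ => (⌈β * n⌉₊ : ℝ) / n) atTop (𝓝 β) :=
    (tendsto_nat_ceil_mul_div_atTop (hα.trans hαβ).le).comp hN
  have hi : Tendsto (fun n : ℕ => 1 / (n:ℝ)) atTop (𝓝 0) := tendsto_one_div_atTop_nhds_zero_nat
  -- ordering of the indices
  have hord : ∀ᶠ n : ℕ in atTop, 1 ≤ n ∧ ⌊α * n⌋₊ + 2 ≤ ⌈β * n⌉₊ ∧ ⌊α * n⌋₊ + 1 ≤ n := by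
    have e : ∀ᶠ n : ℕ in atTop, 2 ≤ (β - α) * (n:ℝ) :=
      (hN.const_mul_atTop (sub_pos.2 hαβ)).eventually_ge_atTop 2
    filter_upwards [e, eventually_ge_atTop 1] with n h1 hn
    have hn' : (0:ℝ) < n := by exact_mod_cast hn
    have f1 : (⌊α * n⌋₊ : ℝ) ≤ α * n := Nat.floor_le (by positivity)
    have f2 : β * n ≤ (⌈β * n⌉₊ : ℝ) := Nat.le_ceil _
    refine ⟨hn, ?_, ?_⟩
    · have : ((⌊α * n⌋₊ + 2 : ℕ) : ℝ) ≤ (⌈β * n⌉₊ : ℝ) := by push_cast; linarith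
      exact_mod_cast this
    · have : (⌊α * n⌋₊ : ℝ) < n := by nlinarith
      exact_mod_cast this
  have hr1 : Tendsto (fun n : ℕ => ((⌈β * n⌉₊ - 1 : ℕ) : ℝ) / n) atTop (𝓝 β) := by
    have := hb.sub hi
    rw [sub_zero] at this
    refine this.congr' ?_
    filter_upwards [hord] with n ⟨h1, h2, h3⟩
    rw [Nat.cast_sub (by omega)]; push_cast; ring
  have hr2 : Tendsto (fun n : ℕ => ((n - ⌊α * n⌋₊ : ℕ) : ℝ) / n) atTop (𝓝 (1 - α)) := by
    refine (ha.const_sub 1).congr' ?_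
    filter_upwards [hord] with n ⟨h1, h2, h3⟩
    have hn' : (n:ℝ) ≠ 0 := by positivity
    rw [Nat.cast_sub (by omega), sub_div, div_self hn']
  have hr3 : Tendsto (fun n : ℕ => ((⌈β * n⌉₊ - ⌊α * n⌋₊ - 1 : ℕ) : ℝ) / n) atTop (𝓝 (β - α)) := by
    have := (hb.sub ha).sub hi
    rw [sub_zero] at this
    refine this.congr' ?_
    filter_upwards [hord] with n ⟨h1, h2, h3⟩
    rw [Nat.cast_sub (by omega), Nat.cast_sub (by omega)]; push_cast; ring
  have lift : ∀ (r : ℕ → ℕ) (δ : ℝ), 0 < δ → Tendsto (fun n : ℕ => (r n : ℝ) / n) atTop (𝓝 δ) →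
      Tendsto r atTop atTop := by
    intro r δ hδ hr
    have h1 := hr.pos_mul_atTop hδ hN
    refine tendsto_natCast_atTop_iff.1 (h1.congr' ?_)
    filter_upwards [eventually_ge_atTop 1] with n hn
    have hn' : (n:ℝ) ≠ 0 := by positivity
    field_simp
  have p1 : 0 < β := hα.trans hαβ
  have p2 : 0 < 1 - α := by linarith
  have p3 : 0 < β - α := by linarith
  have u1 := hc.comp (lift _ _ p1 hr1)
  have u2 := hc.comp (lift _ _ p2 hr2)
  have u3 := hc.comp (lift _ _ p3 hr3)
  have hlog := (((hr1.mul hr2).div hr3 p3.ne').log (by positivity)).const_mul (1/2 : ℝ)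
  have htot := (((u1.add u2).sub u3).sub hc).add hlog
  have hz : c + c - c - c + 1 / 2 * Real.log (β * (1 - α) / (β - α))
      = 1 / 2 * Real.log (β * (1 - α) / (β - α)) := by ring
  rw [hz] at htot
  refine htot.congr' ?_
  filter_upwards [hord] with n ⟨h1, h2, h3⟩
  have q0 : (0:ℝ) < n := by exact_mod_cast h1
  have q1 : (0:ℝ) < ((⌈β * n⌉₊ - 1 : ℕ) : ℝ) := by
    have : 0 < ⌈β * n⌉₊ - 1 := by omega
    exact_mod_cast this
  have q2 : (0:ℝ) < ((n - ⌊α * n⌋₊ : ℕ) : ℝ) := by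
    have : 0 < n - ⌊α * n⌋₊ := by omega
    exact_mod_cast this
  have q3 : (0:ℝ) < ((⌈β * n⌉₊ - ⌊α * n⌋₊ - 1 : ℕ) : ℝ) := by
    have : 0 < ⌈β * n⌉₊ - ⌊α * n⌋₊ - 1 := by omega
    exact_mod_cast this
  have hsum : ((⌈β * n⌉₊ - 1 : ℕ) : ℝ) + ((n - ⌊α * n⌋₊ : ℕ) : ℝ)
      = ((⌈β * n⌉₊ - ⌊α * n⌋₊ - 1 : ℕ) : ℝ) + n := by
    have : (⌈β * n⌉₊ - 1) + (n - ⌊α * n⌋₊) = (⌈β * n⌉₊ - ⌊α * n⌋₊ - 1) + n := by omega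
    exact_mod_cast this
  simp only [Function.comp_apply, Pi.div_apply]
  generalize ⌈β * n⌉₊ - 1 = r1 at *
  generalize n - ⌊α * n⌋₊ = r2 at *
  generalize ⌈β * n⌉₊ - ⌊α * n⌋₊ - 1 = r3 at *
  rw [Real.log_div (by positivity) (by positivity), Real.log_mul (by positivity) (by positivity),
    Real.log_div q1.ne' q0.ne', Real.log_div q2.ne' q0.ne', Real.log_div q3.ne' q0.ne']
  linear_combination (1 + eulerMascheroniConstant) * hsum
end
end

section
/- Let n be a positive integer, p ∈ (0,1), and let X_1,...,X_n be i.i.d. Bernoulli(p) (taking values in {0,1} with P(X_i = 1) = p), with order statistics X_(1) ≤ ... ≤ X_(n). Let B be a Binomial(n, 1−p) random variable (so P(B ≥ k) is the probability that at least k of the X_i equal 0). Then for all integers 1 ≤ r ≤ m ≤ n, the mutual information between X_(r) and X_(m) equals −P(B ≥ m)·log(P(B ≥ r)) + (P(B ≥ r) − P(B ≥ m))·log((P(B ≥ r) − P(B ≥ m)) / (P(B ≥ r)·(1 − P(B ≥ m)))) − (1 − P(B ≥ r))·log(1 − P(B ≥ m)), with the convention 0·log 0 = 0. -/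
open MeasureTheory Real Filter Topology Classical

noncomputable section

/-- The Bernoulli(p) law on `ℝ`, taking value `1` with probability `p` and `0` with
probability `1 - p`. -/
def bernoulliReal (p : ℝ) : Measure ℝ :=
  (ENNReal.ofReal p) • Measure.dirac 1 + (ENNReal.ofReal (1 - p)) • Measure.dirac 0

/-- `P(B ≥ k)` for `B ~ Binomial(n, 1-p)`. -/
def Pge (n : ℕ) (p : ℝ) (k : ℕ) : ℝ :=
  ∑ j ∈ Finset.Icc k n, (n.choose j : ℝ) * (1 - p) ^ j * p ^ (n - j)

/-- The event that at least `k` coordinates are nonpositive. -/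
def zeroEvent (n k : ℕ) : Set (Fin n → ℝ) :=
  {x | k ≤ (Finset.univ.filter fun i => x i ≤ 0).card}

lemma zeroEvent_anti (n : ℕ) {k l : ℕ} (h : k ≤ l) : zeroEvent n l ⊆ zeroEvent n k :=
  fun _ hx => le_trans h hx

lemma zeroEvent_eq (n k : ℕ) : zeroEvent n k =
    ⋃ A ∈ (Finset.univ.filter fun A : Finset (Fin n) => k ≤ A.card),
      Set.pi Set.univ (fun i => if i ∈ A then Set.Iic (0 : ℝ) else Set.Ioi 0) := by
  ext x
  simp only [zeroEvent, Set.mem_ofPred_eq, Set.mem_iUnion, Finset.mem_filter, Finset.mem_univ,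
    true_and, exists_prop, Set.mem_pi, forall_true_left]
  constructor
  · intro h
    refine ⟨_, h, fun i => ?_⟩
    by_cases hi : x i ≤ 0
    · simp [hi]
    · have hi' := not_le.1 hi
      simp [hi, hi']
  · rintro ⟨A, hA, h⟩
    convert hA using 2
    ext i
    have := h i
    by_cases hi : i ∈ A
    · simpa [hi] using this
    · simpa [hi] using this

lemma measurableSet_box {n : ℕ} (A : Finset (Fin n)) : MeasurableSet
    (Set.pi Set.univ (fun i => if i ∈ A then Set.Iic (0 : ℝ) else Set.Ioi 0)) := by
  refine MeasurableSet.univ_pi fun i => ?_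
  split_ifs
  · exact measurableSet_Iic
  · exact measurableSet_Ioi

lemma measurableSet_zeroEvent (n k : ℕ) : MeasurableSet (zeroEvent n k) := by
  rw [zeroEvent_eq]
  exact Finset.measurableSet_biUnion _ fun A _ => measurableSet_box A

lemma isProb_bernoulliReal {p : ℝ} (hp : p ∈ Set.Ioo (0 : ℝ) 1) :
    IsProbabilityMeasure (bernoulliReal p) := by
  constructor
  have h1 : 0 ≤ p := hp.1.le
  have h2 : 0 ≤ 1 - p := by linarith [hp.2]
  simp [bernoulliReal, ← ENNReal.ofReal_add h1 h2]

lemma bernoulliReal_Iic (p : ℝ) : bernoulliReal p (Set.Iic 0) = ENNReal.ofReal (1 - p) := by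
  simp [bernoulliReal]

lemma bernoulliReal_Ioi (p : ℝ) : bernoulliReal p (Set.Ioi 0) = ENNReal.ofReal p := by
  simp [bernoulliReal]

lemma ae_bernoulliReal (p : ℝ) : ∀ᵐ x ∂(bernoulliReal p), x = 0 ∨ x = 1 := by
  have hm : MeasurableSet {x : ℝ | x = 0 ∨ x = 1}ᶜ :=
    ((Set.finite_singleton (1 : ℝ)).insert 0).measurableSet.compl
  rw [ae_iff]
  change bernoulliReal p {x : ℝ | x = 0 ∨ x = 1}ᶜ = 0
  simp [bernoulliReal, hm]

lemma sampleLaw_box {n : ℕ} {p : ℝ} (hp : p ∈ Set.Ioo (0 : ℝ) 1) (A : Finset (Fin n)) :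
    sampleLaw n (bernoulliReal p)
      (Set.pi Set.univ (fun i => if i ∈ A then Set.Iic (0 : ℝ) else Set.Ioi 0))
      = ENNReal.ofReal ((1 - p) ^ A.card * p ^ (n - A.card)) := by
  have := isProb_bernoulliReal hp
  have h1 : 0 ≤ p := hp.1.le
  have h2 : 0 ≤ 1 - p := by linarith [hp.2]
  have e : ∀ i, bernoulliReal p (if i ∈ A then Set.Iic (0 : ℝ) else Set.Ioi 0)
      = if i ∈ A then ENNReal.ofReal (1 - p) else ENNReal.ofReal p := by
    intro i
    split_ifs
    · exact bernoulliReal_Iic p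
    · exact bernoulliReal_Ioi p
  rw [sampleLaw, Measure.pi_pi, Finset.prod_congr rfl fun i _ => e i, Finset.prod_ite,
    Finset.prod_const, Finset.prod_const, ENNReal.ofReal_mul (by positivity),
    ENNReal.ofReal_pow h2, ENNReal.ofReal_pow h1]
  have c1 : (Finset.univ.filter fun i => i ∈ A) = A := by ext; simp
  have c2 : (Finset.univ.filter fun i => i ∉ A) = Aᶜ := by ext; simp
  rw [c1, c2, Finset.card_compl, Fintype.card_fin]

lemma sum_card_ge (n k : ℕ) (f : ℕ → ℝ) :
    ∑ A ∈ (Finset.univ.filter fun A : Finset (Fin n) => k ≤ A.card), f A.card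
      = ∑ j ∈ Finset.Icc k n, (n.choose j : ℝ) * f j := by
  have h := Finset.sum_powerset_apply_card (fun j => if k ≤ j then f j else 0)
    (x := (Finset.univ : Finset (Fin n)))
  rw [Finset.sum_filter, ← Finset.powerset_univ, h, Finset.card_univ, Fintype.card_fin]
  have : Finset.Icc k n = (Finset.range (n + 1)).filter fun j => k ≤ j := by
    ext j; simp; omega
  rw [this, Finset.sum_filter]
  refine Finset.sum_congr rfl fun j _ => ?_
  split_ifs <;> simp

lemma sampleLaw_zeroEvent {n : ℕ} {p : ℝ} (hp : p ∈ Set.Ioo (0 : ℝ) 1) (k : ℕ) :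
    sampleLaw n (bernoulliReal p) (zeroEvent n k) = ENNReal.ofReal (Pge n p k) := by
  have h1 : 0 ≤ p := hp.1.le
  have h2 : 0 ≤ 1 - p := by linarith [hp.2]
  rw [zeroEvent_eq, measure_biUnion_finset _ fun A _ => measurableSet_box A,
    Finset.sum_congr rfl fun A _ => sampleLaw_box hp A, ← ENNReal.ofReal_sum_of_nonneg
      (fun A _ => by positivity),
    sum_card_ge n k fun j => (1 - p) ^ j * p ^ (n - j)]
  · simp only [Pge, mul_assoc]
  · intro A _ B _ hAB
    refine Set.disjoint_left.2 fun x hx hy => hAB ?_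
    ext i
    have a := hx i trivial
    have b := hy i trivial
    by_cases hA : i ∈ A <;> by_cases hB : i ∈ B <;> simp_all
    · exact absurd a (not_le.2 b)
    · exact absurd b (not_le.2 a)

lemma Pge_pos {n : ℕ} {p : ℝ} (hp : p ∈ Set.Ioo (0 : ℝ) 1) {k : ℕ} (hk : k ≤ n) :
    0 < Pge n p k := by
  have h1 : 0 < p := hp.1
  have h2 : 0 < 1 - p := by linarith [hp.2]
  refine Finset.sum_pos (fun j hj => ?_) ⟨n, by simp [hk]⟩
  have := Nat.choose_pos (Finset.mem_Icc.1 hj).2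
  positivity

lemma Pge_zero (n : ℕ) (p : ℝ) : Pge n p 0 = 1 := by
  have h := add_pow (1 - p) p n
  simp only [sub_add_cancel, one_pow] at h
  rw [h, Pge, Nat.range_succ_eq_Icc_zero]
  exact Finset.sum_congr rfl fun _ _ => by ring

lemma Pge_anti {n : ℕ} {p : ℝ} (hp : p ∈ Set.Ioo (0 : ℝ) 1) {k l : ℕ} (h : k ≤ l) :
    Pge n p l ≤ Pge n p k := by
  have h1 : 0 ≤ p := hp.1.le
  have h2 : 0 ≤ 1 - p := by linarith [hp.2]
  exact Finset.sum_le_sum_of_subset_of_nonneg (Finset.Icc_subset_Icc_left h)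
    fun j _ _ => by positivity

lemma Pge_lt_one {n : ℕ} {p : ℝ} (hp : p ∈ Set.Ioo (0 : ℝ) 1) {k : ℕ} (hk : 1 ≤ k) :
    Pge n p k < 1 := by
  have h1 : 0 < p := hp.1
  have h2 : 0 < 1 - p := by linarith [hp.2]
  refine (Pge_anti hp hk).trans_lt ?_
  rw [← Pge_zero n p]
  refine Finset.sum_lt_sum_of_subset (i := 0) (Finset.Icc_subset_Icc_left (by omega)) (by simp)
    (by simp) ?_ fun j _ _ => by positivity
  simp; positivity

lemma sortTuple_ae {n : ℕ} {p : ℝ} (hp : p ∈ Set.Ioo (0 : ℝ) 1) (i : Fin n) (k : ℕ)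
    (hk : k = i.val + 1) :
    ∀ᵐ x ∂(sampleLaw n (bernoulliReal p)),
      sortTuple x i = if x ∈ zeroEvent n k then 0 else 1 := by
  have := isProb_bernoulliReal hp
  have h : ∀ᵐ x ∂(sampleLaw n (bernoulliReal p)), ∀ j, x j = 0 ∨ x j = 1 :=
    by
    rw [sampleLaw]
    exact eventually_all.2 fun j => (Measure.tendsto_eval_ae_ae
      (μ := fun _ : Fin n => bernoulliReal p) (i := j)).eventually (ae_bernoulliReal p)
  filter_upwards [h] with x hx
  have key := Tuple.lt_card_le_iff_apply_le_of_monotone (j := i) (a := (0 : ℝ))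
    (Tuple.monotone_sort x)
  have hc : (Finset.univ.filter fun i => (x ∘ Tuple.sort x) i ≤ 0).card
      = (Finset.univ.filter fun i => x i ≤ 0).card :=
    Finset.card_equiv (Tuple.sort x) (by simp)
  have hmem : x ∈ zeroEvent n k ↔ sortTuple x i ≤ 0 := by
    rw [zeroEvent, Set.mem_ofPred_eq, ← hc, hk, Nat.succ_le_iff]
    exact key
  have hv : sortTuple x i = 0 ∨ sortTuple x i = 1 := hx _
  rcases hv with hv | hv
  · rw [if_pos (hmem.2 hv.le), hv]
  · rw [if_neg (by rw [hmem, hv]; norm_num), hv]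

lemma map_restrict_const {α β : Type*} [MeasurableSpace α] [MeasurableSpace β] (S : Measure α)
    {E : Set α} (hE : MeasurableSet E) (f : α → β) (c : β) (h : ∀ x ∈ E, f x = c) :
    (S.restrict E).map f = S E • Measure.dirac c := by
  have : f =ᵐ[S.restrict E] fun _ => c := (ae_restrict_iff' hE).2 (ae_of_all _ h)
  rw [Measure.map_congr this, Measure.map_const, Measure.restrict_apply_univ]

lemma osLaw_eq {n : ℕ} {p : ℝ} (hp : p ∈ Set.Ioo (0 : ℝ) 1) (i : Fin n) (k : ℕ)
    (hk : k = i.val + 1) : osLaw n (bernoulliReal p) i =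
      ENNReal.ofReal (Pge n p k) • Measure.dirac 0
        + ENNReal.ofReal (1 - Pge n p k) • Measure.dirac 1 := by
  have := isProb_bernoulliReal hp
  have : IsProbabilityMeasure (sampleLaw n (bernoulliReal p)) := by
    unfold sampleLaw; infer_instance
  have hE := measurableSet_zeroEvent n k
  have hf : Measurable fun x => if x ∈ zeroEvent n k then (0 : ℝ) else 1 :=
    Measurable.ite hE measurable_const measurable_const
  have hnn : 0 ≤ Pge n p k := Finset.sum_nonneg fun j _ => by
    have h1 : 0 ≤ p := hp.1.le
    have h2 : 0 ≤ 1 - p := by linarith [hp.2]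
    positivity
  rw [osLaw, Measure.map_congr (sortTuple_ae hp i k hk)]
  conv_lhs => rw [← Measure.restrict_add_restrict_compl (μ := sampleLaw n (bernoulliReal p)) hE]
  rw [Measure.map_add _ _ hf, map_restrict_const _ hE _ 0 (fun x hx => if_pos hx),
    map_restrict_const _ hE.compl _ 1 (fun x hx => if_neg hx), prob_compl_eq_one_sub hE,
    sampleLaw_zeroEvent hp, ENNReal.ofReal_sub _ hnn,
    ENNReal.ofReal_one]

lemma joint_eq {n : ℕ} {p : ℝ} (hp : p ∈ Set.Ioo (0 : ℝ) 1) (i j : Fin n) (k l : ℕ)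
    (hk : k = i.val + 1) (hl : l = j.val + 1) (hkl : k ≤ l) :
    (sampleLaw n (bernoulliReal p)).map (fun x => (sortTuple x i, sortTuple x j)) =
      ENNReal.ofReal (Pge n p l) • Measure.dirac (0, 0)
        + (ENNReal.ofReal (Pge n p k - Pge n p l) • Measure.dirac (0, 1)
        + ENNReal.ofReal (1 - Pge n p k) • Measure.dirac (1, 1)) := by
  have := isProb_bernoulliReal hp
  have : IsProbabilityMeasure (sampleLaw n (bernoulliReal p)) := by
    unfold sampleLaw; infer_instance
  have hE := measurableSet_zeroEvent n k
  have hF := measurableSet_zeroEvent n l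
  have hsub := zeroEvent_anti n hkl
  have hae : (fun x => (sortTuple x i, sortTuple x j)) =ᵐ[sampleLaw n (bernoulliReal p)]
      fun x => ((if x ∈ zeroEvent n k then (0 : ℝ) else 1),
        (if x ∈ zeroEvent n l then (0 : ℝ) else 1)) := by
    filter_upwards [sortTuple_ae hp i k hk, sortTuple_ae hp j l hl] with x h1 h2
    rw [h1, h2]
  have hf : Measurable fun x => ((if x ∈ zeroEvent n k then (0 : ℝ) else 1),
        (if x ∈ zeroEvent n l then (0 : ℝ) else 1)) :=
    (Measurable.ite hE measurable_const measurable_const).prodMk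
      (Measurable.ite hF measurable_const measurable_const)
  have hdec : sampleLaw n (bernoulliReal p) =
      (sampleLaw n (bernoulliReal p)).restrict (zeroEvent n l) +
      ((sampleLaw n (bernoulliReal p)).restrict (zeroEvent n k \ zeroEvent n l) +
      (sampleLaw n (bernoulliReal p)).restrict (zeroEvent n k)ᶜ) := by
    rw [← add_assoc, ← Measure.restrict_union Set.disjoint_sdiff_right (hE.diff hF),
      Set.union_sdiff_cancel hsub, Measure.restrict_add_restrict_compl hE]
  have hnn : ∀ q, 0 ≤ Pge n p q := fun q => Finset.sum_nonneg fun j _ => by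
    have h1 : 0 ≤ p := hp.1.le
    have h2 : 0 ≤ 1 - p := by linarith [hp.2]
    positivity
  rw [Measure.map_congr hae]
  conv_lhs => rw [hdec]
  rw [Measure.map_add _ _ hf, Measure.map_add _ _ hf,
    map_restrict_const _ hF _ (0, 0) (fun x hx => by simp [hx, hsub hx]),
    map_restrict_const _ (hE.diff hF) _ (0, 1) (fun x hx => by simp [hx.1, hx.2]),
    map_restrict_const _ hE.compl _ (1, 1)
      (fun x hx => by rw [if_neg hx, if_neg (fun h => hx (hsub h))]),
    prob_compl_eq_one_sub hE, measure_sdiff hsub hF.nullMeasurableSet (measure_ne_top _ _),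
    sampleLaw_zeroEvent hp, sampleLaw_zeroEvent hp, ENNReal.ofReal_sub _ (hnn l),
    ENNReal.ofReal_sub _ (hnn k), ENNReal.ofReal_one]

/-- Density of the joint law with respect to the product of the marginals. -/
def dens (a b : ℝ) (z : ℝ × ℝ) : ℝ :=
  if z.1 = 0 then (if z.2 = 0 then 1 / a else (a - b) / (a * (1 - b)))
  else (if z.2 = 0 then 0 else 1 / (1 - b))

lemma measurable_dens (a b : ℝ) : Measurable (dens a b) := by
  have h1 : MeasurableSet {z : ℝ × ℝ | z.1 = 0} := measurable_fst (measurableSet_singleton 0)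
  have h2 : MeasurableSet {z : ℝ × ℝ | z.2 = 0} := measurable_snd (measurableSet_singleton 0)
  exact Measurable.ite h1 (Measurable.ite h2 measurable_const measurable_const)
    (Measurable.ite h2 measurable_const measurable_const)

lemma klDiv_two_point {a b : ℝ} (hb : 0 < b) (hab : b ≤ a) (ha : a < 1) :
    klDiv (ENNReal.ofReal b • Measure.dirac ((0 : ℝ), (0 : ℝ))
        + (ENNReal.ofReal (a - b) • Measure.dirac ((0 : ℝ), (1 : ℝ))
        + ENNReal.ofReal (1 - a) • Measure.dirac ((1 : ℝ), (1 : ℝ))))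
      ((ENNReal.ofReal a • Measure.dirac (0 : ℝ) + ENNReal.ofReal (1 - a) • Measure.dirac 1).prod
        (ENNReal.ofReal b • Measure.dirac (0 : ℝ) + ENNReal.ofReal (1 - b) • Measure.dirac 1))
      = ((-b * Real.log a + (a - b) * Real.log ((a - b) / (a * (1 - b)))
          - (1 - a) * Real.log (1 - b) : ℝ) : EReal) := by
  have ha0 : 0 < a := hb.trans_le hab
  have ha1 : 0 < 1 - a := by linarith
  have hb1 : 0 < 1 - b := by linarith
  have hab' : 0 ≤ a - b := by linarith
  set Q := (ENNReal.ofReal a • Measure.dirac (0 : ℝ)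
        + ENNReal.ofReal (1 - a) • Measure.dirac 1).prod
        (ENNReal.ofReal b • Measure.dirac (0 : ℝ) + ENNReal.ofReal (1 - b) • Measure.dirac 1)
    with hQ
  set P := ENNReal.ofReal b • Measure.dirac ((0 : ℝ), (0 : ℝ))
        + (ENNReal.ofReal (a - b) • Measure.dirac ((0 : ℝ), (1 : ℝ))
        + ENNReal.ofReal (1 - a) • Measure.dirac ((1 : ℝ), (1 : ℝ))) with hP
  have hmeas := (measurable_dens a b).ennreal_ofReal
  have hQfin : IsFiniteMeasure Q := by
    refine ⟨?_⟩
    rw [hQ, ← Set.univ_prod_univ, Measure.prod_prod]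
    simp [ENNReal.mul_lt_top]
  have hPQ : P = Q.withDensity fun z => ENNReal.ofReal (dens a b z) := by
    have hQ' : Q = ENNReal.ofReal (a * b) • Measure.dirac ((0 : ℝ), (0 : ℝ))
        + ENNReal.ofReal (a * (1 - b)) • Measure.dirac ((0 : ℝ), (1 : ℝ))
        + (ENNReal.ofReal ((1 - a) * b) • Measure.dirac ((1 : ℝ), (0 : ℝ))
        + ENNReal.ofReal ((1 - a) * (1 - b)) • Measure.dirac ((1 : ℝ), (1 : ℝ))) := by
      rw [hQ, Measure.add_prod]
      simp only [Measure.prod_add, Measure.prod_smul_left, Measure.prod_smul_right,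
        Measure.dirac_prod_dirac, smul_add, smul_smul]
      rw [ENNReal.ofReal_mul ha0.le, ENNReal.ofReal_mul ha0.le, ENNReal.ofReal_mul ha1.le,
        ENNReal.ofReal_mul ha1.le]
      simp only [mul_comm]
    rw [hQ', withDensity_add_measure, withDensity_add_measure, withDensity_add_measure]
    simp only [withDensity_smul_measure, dirac_withDensity, smul_smul]
    rw [← ENNReal.ofReal_mul (by positivity), ← ENNReal.ofReal_mul (by positivity),
      ← ENNReal.ofReal_mul (by positivity), ← ENNReal.ofReal_mul (by positivity)]
    have e1 : a * b * dens a b (0, 0) = b := by simp [dens]; field_simp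
    have e2 : a * (1 - b) * dens a b (0, 1) = a - b := by simp [dens]; field_simp
    have e3 : (1 - a) * b * dens a b (1, 0) = 0 := by simp [dens]
    have e4 : (1 - a) * (1 - b) * dens a b (1, 1) = 1 - a := by simp [dens]; field_simp
    rw [e1, e2, e3, e4, hP]
    simp [add_assoc]
  have hac : P ≪ Q := hPQ ▸ withDensity_absolutelyContinuous _ _
  have hrn : ∀ᵐ z ∂P, Real.log ((P.rnDeriv Q z).toReal)
      = Real.log ((ENNReal.ofReal (dens a b z)).toReal) := by
    refine hac.ae_le ?_
    have := Measure.rnDeriv_withDensity Q hmeas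
    rw [← hPQ] at this
    filter_upwards [this] with z hz
    rw [hz]
  rw [klDiv, if_pos hac, integral_congr_ae hrn]
  congr 1
  have hint : ∀ (c : ℝ) (w : ℝ × ℝ), Integrable
      (fun z => Real.log ((ENNReal.ofReal (dens a b z)).toReal))
      (ENNReal.ofReal c • Measure.dirac w) := fun c w =>
    (integrable_dirac (by simp)).smul_measure ENNReal.ofReal_ne_top
  rw [hP, integral_add_measure (hint _ _) ((hint _ _).add_measure (hint _ _)),
    integral_add_measure (hint _ _) (hint _ _)]
  simp only [integral_smul_measure, integral_dirac, ENNReal.toReal_ofReal hb.le,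
    ENNReal.toReal_ofReal hab', ENNReal.toReal_ofReal ha1.le, smul_eq_mul]
  have d1 : dens a b (0, 0) = a⁻¹ := by simp [dens]
  have d2 : dens a b (0, 1) = (a - b) / (a * (1 - b)) := by simp [dens]
  have d3 : dens a b (1, 1) = (1 - b)⁻¹ := by simp [dens]
  rw [d1, d2, d3, ENNReal.toReal_ofReal (by positivity), ENNReal.toReal_ofReal (by positivity),
    ENNReal.toReal_ofReal (by positivity), Real.log_inv, Real.log_inv]
  ring

/-- Mutual information between the `r`-th and `m`-th order statistics (1-based) of an
i.i.d. Bernoulli(p) sample, in terms of the tail probabilities of `B ~ Binomial(n, 1-p)`. -/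
theorem mutualInfo_bernoulli_orderStatistics
    (n : ℕ) (hn : 0 < n) (p : ℝ) (hp : p ∈ Set.Ioo (0 : ℝ) 1)
    (r m : ℕ) (hr : 1 ≤ r) (hrm : r ≤ m) (hmn : m ≤ n) :
    miPair n (bernoulliReal p) ⟨r - 1, by omega⟩ ⟨m - 1, by omega⟩
      = ((-Pge n p m * Real.log (Pge n p r)
          + (Pge n p r - Pge n p m) *
              Real.log ((Pge n p r - Pge n p m) / (Pge n p r * (1 - Pge n p m)))
          - (1 - Pge n p r) * Real.log (1 - Pge n p m) : ℝ) : EReal) := by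
  have hk : r = (⟨r - 1, by omega⟩ : Fin n).val + 1 := by simp; omega
  have hl : m = (⟨m - 1, by omega⟩ : Fin n).val + 1 := by simp; omega
  rw [miPair, joint_eq hp _ _ r m hk hl hrm, osLaw_eq hp _ r hk, osLaw_eq hp _ m hl]
  exact klDiv_two_point (Pge_pos hp hmn) (Pge_anti hp hrm) (Pge_lt_one hp hr)
end
end

section
/- Let n be a positive integer, let μ be an arbitrary probability measure on ℝ, and let X_1,...,X_n be i.i.d. with law μ, with order statistics X_(1) ≤ ... ≤ X_(n). Let U_1,...,U_n be i.i.d. uniform on (0,1) with order statistics U_(1) ≤ ... ≤ U_(n). Then for all integers 1 ≤ r < m ≤ n, the mutual information satisfies I(X_(r); X_(m)) ≤ I(U_(r); U_(m)) = T_{m−1} + T_{n−r} − T_{m−r−1} − T_n. -/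
open MeasureTheory Real Filter Topology Classical

noncomputable section

/-- Beta function value at natural arguments (shifted by one). -/
def Bt (p q : ℕ) : ℝ := (p.factorial * q.factorial : ℝ) / (p + q + 1).factorial

lemma Bt_pos (p q : ℕ) : 0 < Bt p q := by unfold Bt; positivity

lemma Bt_zero (p : ℕ) : Bt p 0 = 1 / (p + 1) := by
  unfold Bt
  rw [add_zero, Nat.factorial_succ]
  push_cast
  have : (p.factorial : ℝ) ≠ 0 := by positivity
  field_simp
  simp

lemma Bt_succ_left (p q : ℕ) : Bt (p + 1) q = Bt p q * ((p + 1) / (p + q + 2)) := by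
  unfold Bt
  rw [show p + 1 + q + 1 = (p + q + 1) + 1 by ring, Nat.factorial_succ (p + q + 1),
    Nat.factorial_succ p]
  push_cast
  have : (p.factorial : ℝ) ≠ 0 := by positivity
  have : ((p + q + 1).factorial : ℝ) ≠ 0 := by positivity
  field_simp
  ring

lemma Bt_succ_right (p q : ℕ) : Bt p (q + 1) = Bt p q * ((q + 1) / (p + q + 2)) := by
  unfold Bt
  rw [show p + (q + 1) + 1 = (p + q + 1) + 1 by ring, Nat.factorial_succ (p + q + 1),
    Nat.factorial_succ q]
  push_cast
  have : (p.factorial : ℝ) ≠ 0 := by positivity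
  have : ((p + q + 1).factorial : ℝ) ≠ 0 := by positivity
  field_simp
  ring

lemma beta_interval (L : ℝ) (p q : ℕ) :
    ∫ z in (0:ℝ)..L, z ^ p * (L - z) ^ q = Bt p q * L ^ (p + q + 1) := by
  induction q generalizing p with
  | zero => simp [Bt_zero, integral_pow]; ring
  | succ q ih =>
    have h : ∀ z : ℝ, z ^ p * (L - z) ^ (q + 1) =
        L * (z ^ p * (L - z) ^ q) - z ^ (p + 1) * (L - z) ^ q := by intro z; ring
    simp_rw [h]
    rw [intervalIntegral.integral_sub, intervalIntegral.integral_const_mul, ih, ih,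
      Bt_succ_left, Bt_succ_right]
    · have : (p + q + 2 : ℝ) ≠ 0 := by positivity
      field_simp
      ring
    · exact (by fun_prop : Continuous _).intervalIntegrable _ _
    · exact (by fun_prop : Continuous _).intervalIntegrable _ _

lemma beta_lintegral (L : ℝ) (hL : 0 < L) (p q : ℕ) (k : ℝ) (hk : 0 ≤ k) :
    ∫⁻ z, (Set.Ioo 0 L).indicator (fun z => ENNReal.ofReal (k * (z ^ p * (L - z) ^ q))) z =
      ENNReal.ofReal (k * (Bt p q * L ^ (p + q + 1))) := by
  rw [lintegral_indicator measurableSet_Ioo, ← ofReal_integral_eq_lintegral_ofReal]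
  · congr 1
    rw [integral_const_mul, ← beta_interval, intervalIntegral.integral_of_le hL.le,
      integral_Ioc_eq_integral_Ioo]
  · exact ((by fun_prop : Continuous fun z : ℝ => k * (z ^ p * (L - z) ^ q)).integrableOn_Icc
      (a := 0) (b := L)).mono_set Set.Ioo_subset_Icc_self
  · refine (ae_restrict_iff' measurableSet_Ioo).2 (ae_of_all _ fun z hz => ?_)
    have h1 : 0 ≤ z := hz.1.le
    have h2 : 0 ≤ L - z := by linarith [hz.2]
    simp only [Pi.zero_apply]
    positivity

lemma log_interval_int (p q : ℕ) :
    IntervalIntegrable (fun z : ℝ => z ^ p * (1 - z) ^ q * Real.log z) volume 0 1 := by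
  apply IntervalIntegrable.continuousOn_mul
  · exact intervalIntegral.intervalIntegrable_log'
  · exact (by fun_prop : Continuous _).continuousOn

lemma log_interval_zero (p : ℕ) :
    ∫ z in (0:ℝ)..1, z ^ p * Real.log z = - (1 / (p + 1) ^ 2) := by
  have hp : (p + 1 : ℝ) ≠ 0 := by positivity
  rw [intervalIntegral.integral_eq_sub_of_hasDerivAt_of_le
    (f := fun z => z ^ p * (z * Real.log z) / (p + 1) - z ^ (p + 1) / (p + 1) ^ 2) zero_le_one]
  · simp
  · have := Real.continuous_mul_log
    exact (by fun_prop : Continuous _).continuousOn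
  · intro z hz
    have hz0 : z ≠ 0 := hz.1.ne'
    have h1 := (((hasDerivAt_pow (p + 1) z).mul (Real.hasDerivAt_log hz0)).div_const
      (p + 1 : ℝ)).sub ((hasDerivAt_pow (p + 1) z).div_const ((p + 1 : ℝ) ^ 2))
    convert! h1 using 1
    · ext w; simp; ring
    · push_cast
      field_simp
      ring
  · have := log_interval_int p 0
    simpa using this

lemma log_interval (p q : ℕ) :
    ∫ z in (0:ℝ)..1, z ^ p * (1 - z) ^ q * Real.log z =
      Bt p q * ((harmonic p : ℝ) - (harmonic (p + q + 1) : ℝ)) := by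
  induction q generalizing p with
  | zero =>
    simp only [pow_zero, mul_one, add_zero]
    rw [log_interval_zero, Bt_zero, harmonic_succ]
    push_cast
    field_simp
    ring
  | succ q ih =>
    have h : ∀ z : ℝ, z ^ p * (1 - z) ^ (q + 1) * Real.log z =
        (z ^ p * (1 - z) ^ q * Real.log z) - z ^ (p + 1) * (1 - z) ^ q * Real.log z := by
      intro z; ring
    simp_rw [h]
    rw [intervalIntegral.integral_sub (log_interval_int _ _) (log_interval_int _ _), ih, ih,
      Bt_succ_left, Bt_succ_right, show p + (q + 1) + 1 = (p + q + 1) + 1 by ring,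
      show p + 1 + q + 1 = (p + q + 1) + 1 by ring, harmonic_succ p, harmonic_succ (p + q + 1)]
    push_cast
    have : (p + q + 1 + 1 : ℝ) ≠ 0 := by positivity
    have : (p + q + 2 : ℝ) ≠ 0 := by positivity
    have : (p + 1 : ℝ) ≠ 0 := by positivity
    field_simp
    ring

/-- Beta density. -/
def bet (p q : ℕ) (z : ℝ) : ENNReal :=
  (Set.Ioo (0:ℝ) 1).indicator (fun z => ENNReal.ofReal ((Bt p q)⁻¹ * (z ^ p * (1 - z) ^ q))) z

lemma measurable_bet (p q : ℕ) : Measurable (bet p q) := by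
  unfold bet
  exact Measurable.indicator (by fun_prop) measurableSet_Ioo

lemma bet_symm (p q : ℕ) (z : ℝ) : bet q p (1 - z) = bet p q z := by
  unfold bet
  by_cases hz : z ∈ Set.Ioo (0:ℝ) 1
  · have hz' : 1 - z ∈ Set.Ioo (0:ℝ) 1 := ⟨by linarith [hz.2], by linarith [hz.1]⟩
    rw [Set.indicator_of_mem hz, Set.indicator_of_mem hz']
    congr 1
    unfold Bt
    rw [add_comm q p]
    ring
  · have hz' : 1 - z ∉ Set.Ioo (0:ℝ) 1 := fun h => hz ⟨by linarith [h.2], by linarith [h.1]⟩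
    rw [Set.indicator_of_notMem hz, Set.indicator_of_notMem hz']

lemma bet_toReal_smul_log (p q : ℕ) : (fun z => (bet p q z).toReal • Real.log z) =
    (Set.Ioo (0:ℝ) 1).indicator
      (fun z => (Bt p q)⁻¹ * (z ^ p * (1 - z) ^ q * Real.log z)) := by
  ext z
  unfold bet
  by_cases hz : z ∈ Set.Ioo (0:ℝ) 1
  · rw [Set.indicator_of_mem hz, Set.indicator_of_mem hz, ENNReal.toReal_ofReal, smul_eq_mul]
    · ring
    · have h1 : 0 ≤ z := hz.1.le
      have h2 : 0 ≤ 1 - z := by linarith [hz.2]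
      have := (Bt_pos p q).le
      positivity
  · rw [Set.indicator_of_notMem hz, Set.indicator_of_notMem hz]; simp

lemma bet_lt_top (p q : ℕ) (z : ℝ) : bet p q z < ⊤ := by
  unfold bet
  by_cases hz : z ∈ Set.Ioo (0:ℝ) 1
  · rw [Set.indicator_of_mem hz]; exact ENNReal.ofReal_lt_top
  · rw [Set.indicator_of_notMem hz]; simp

lemma bet_log (p q : ℕ) : Integrable Real.log (volume.withDensity (bet p q)) ∧
    ∫ z, Real.log z ∂(volume.withDensity (bet p q)) =
      (harmonic p : ℝ) - (harmonic (p + q + 1) : ℝ) := by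
  constructor
  · rw [integrable_withDensity_iff_integrable_smul' (measurable_bet p q)
      (ae_of_all _ (bet_lt_top p q)), bet_toReal_smul_log, integrable_indicator_iff
      measurableSet_Ioo]
    refine Integrable.const_mul ?_ _
    have := (log_interval_int p q).1
    exact IntegrableOn.mono_set this Set.Ioo_subset_Ioc_self
  · rw [integral_withDensity_eq_integral_toReal_smul (measurable_bet p q)
      (ae_of_all _ (bet_lt_top p q)), bet_toReal_smul_log, integral_indicator measurableSet_Ioo,
      integral_const_mul, ← integral_Ioc_eq_integral_Ioo,
      ← intervalIntegral.integral_of_le zero_le_one, log_interval]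
    have := (Bt_pos p q).ne'
    field_simp

lemma bet_map_symm (p q : ℕ) :
    (volume.withDensity (bet p q)).map (fun z => 1 - z) = volume.withDensity (bet q p) := by
  ext s hs
  rw [Measure.map_apply (by fun_prop) hs, withDensity_apply _ hs,
    withDensity_apply _ (hs.preimage (by fun_prop)), ← lintegral_indicator hs,
    ← lintegral_indicator (hs.preimage (by fun_prop)),
    ← lintegral_sub_left_eq_self (s.indicator (bet q p)) 1]
  congr 1
  ext z
  simp only [Set.indicator, Set.mem_preimage, bet_symm]

lemma bet_log' (p q : ℕ) :
    Integrable (fun z => Real.log (1 - z)) (volume.withDensity (bet p q)) ∧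
    ∫ z, Real.log (1 - z) ∂(volume.withDensity (bet p q)) =
      (harmonic q : ℝ) - (harmonic (p + q + 1) : ℝ) := by
  have h := bet_log q p
  rw [← bet_map_symm p q, add_comm q p] at h
  have hm : AEMeasurable (fun z : ℝ => 1 - z) (volume.withDensity (bet p q)) := by fun_prop
  rw [integrable_map_measure Real.measurable_log.aestronglyMeasurable hm,
    integral_map hm Real.measurable_log.aestronglyMeasurable] at h
  exact h

/-- Normalising constant of the joint density. -/
def cst (a b d : ℕ) : ℝ :=
  ((a + b + d + 2).factorial : ℝ) / (a.factorial * b.factorial * d.factorial)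

lemma cst_pos (a b d : ℕ) : 0 < cst a b d := by unfold cst; positivity

/-- The triangle. -/
def tri : Set (ℝ × ℝ) := {z | 0 < z.1 ∧ z.1 < z.2 ∧ z.2 < 1}

lemma measurableSet_tri : MeasurableSet tri := by
  unfold tri
  exact (measurableSet_lt measurable_const measurable_fst).inter
    ((measurableSet_lt measurable_fst measurable_snd).inter
    (measurableSet_lt measurable_snd measurable_const))

/-- Joint density, up to constant `k`. -/
def jd (k : ℝ) (a b d : ℕ) : ℝ × ℝ → ENNReal := tri.indicator fun z =>
  ENNReal.ofReal (k * (z.1 ^ a * (z.2 - z.1) ^ b * (1 - z.2) ^ d))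

lemma measurable_jd (k : ℝ) (a b d : ℕ) : Measurable (jd k a b d) := by
  unfold jd
  exact Measurable.indicator (by fun_prop) measurableSet_tri

/-- Joint law. -/
def JL (a b d : ℕ) : Measure (ℝ × ℝ) := (volume.prod volume).withDensity (jd (cst a b d) a b d)

lemma cst_fst (a b d : ℕ) : cst a b d * Bt b d = (Bt a (b + d + 1))⁻¹ := by
  unfold cst Bt
  rw [show a + (b + d + 1) + 1 = a + b + d + 2 by ring]
  field_simp

lemma cst_snd (a b d : ℕ) : cst a b d * Bt a b = (Bt (a + b + 1) d)⁻¹ := by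
  unfold cst Bt
  rw [show (a + b + 1) + d + 1 = a + b + d + 2 by ring]
  field_simp

lemma cst_diff (a b d : ℕ) : cst a b d * Bt a d = (Bt b (a + d + 1))⁻¹ := by
  unfold cst Bt
  rw [show b + (a + d + 1) + 1 = a + b + d + 2 by ring]
  field_simp

lemma lint_fst (a b d : ℕ) (x : ℝ) :
    ∫⁻ y, jd (cst a b d) a b d (x, y) = bet a (b + d + 1) x := by
  rw [← lintegral_add_left_eq_self _ x]
  by_cases hx : x ∈ Set.Ioo (0:ℝ) 1
  · have h0 : 0 < x := hx.1
    have h1 : 0 < 1 - x := by linarith [hx.2]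
    have hc := (cst_pos a b d).le
    rw [bet, Set.indicator_of_mem hx, ← cst_fst]
    have := beta_lintegral (1 - x) h1 b d (cst a b d * x ^ a) (by positivity)
    rw [show cst a b d * Bt b d * (x ^ a * (1 - x) ^ (b + d + 1)) =
      cst a b d * x ^ a * (Bt b d * (1 - x) ^ (b + d + 1)) by ring, ← this]
    congr 1
    ext z
    unfold jd
    by_cases hz : z ∈ Set.Ioo 0 (1 - x)
    · have : (x, x + z) ∈ tri := ⟨h0, by simpa using hz.1, by
        have := hz.2; simp only; linarith⟩
      rw [Set.indicator_of_mem hz, Set.indicator_of_mem this]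
      congr 1; ring
    · have : (x, x + z) ∉ tri := fun h => hz ⟨by simpa using h.2.1, by
        have := h.2.2; simp only at this; linarith⟩
      rw [Set.indicator_of_notMem hz, Set.indicator_of_notMem this]
  · rw [bet, Set.indicator_of_notMem hx]
    simp only [jd]
    rw [lintegral_eq_zero_iff']
    · refine ae_of_all _ fun z => ?_
      have : (x, x + z) ∉ tri := fun h => hx ⟨h.1, h.2.1.trans h.2.2⟩
      exact Set.indicator_of_notMem this _
    · exact ((measurable_jd _ a b d).comp (by fun_prop : Measurable fun z => (x, x + z))).aemeasurable

lemma lint_snd (a b d : ℕ) (y : ℝ) :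
    ∫⁻ x, jd (cst a b d) a b d (x, y) = bet (a + b + 1) d y := by
  by_cases hx : y ∈ Set.Ioo (0:ℝ) 1
  · have h0 : 0 < y := hx.1
    have h1 : 0 < 1 - y := by linarith [hx.2]
    have hc := (cst_pos a b d).le
    rw [bet, Set.indicator_of_mem hx, ← cst_snd]
    have := beta_lintegral y h0 a b (cst a b d * (1 - y) ^ d) (by positivity)
    rw [show cst a b d * Bt a b * (y ^ (a + b + 1) * (1 - y) ^ d) =
      cst a b d * (1 - y) ^ d * (Bt a b * y ^ (a + b + 1)) by ring, ← this]
    congr 1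
    ext z
    unfold jd
    by_cases hz : z ∈ Set.Ioo 0 y
    · have : (z, y) ∈ tri := ⟨hz.1, hz.2, hx.2⟩
      rw [Set.indicator_of_mem hz, Set.indicator_of_mem this]
      congr 1; ring
    · have : (z, y) ∉ tri := fun h => hz ⟨h.1, h.2.1⟩
      rw [Set.indicator_of_notMem hz, Set.indicator_of_notMem this]
  · rw [bet, Set.indicator_of_notMem hx]
    simp only [jd]
    rw [lintegral_eq_zero_iff']
    · refine ae_of_all _ fun z => ?_
      have : (z, y) ∉ tri := fun h => hx ⟨h.1.trans h.2.1, h.2.2⟩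
      exact Set.indicator_of_notMem this _
    · exact ((measurable_jd _ a b d).comp (by fun_prop : Measurable fun z => (z, y))).aemeasurable

lemma lint_diff (a b d : ℕ) (z : ℝ) :
    ∫⁻ x, jd (cst a b d) a b d (x, x + z) = bet b (a + d + 1) z := by
  by_cases hx : z ∈ Set.Ioo (0:ℝ) 1
  · have h0 : 0 < z := hx.1
    have h1 : 0 < 1 - z := by linarith [hx.2]
    have hc := (cst_pos a b d).le
    rw [bet, Set.indicator_of_mem hx, ← cst_diff]
    have := beta_lintegral (1 - z) h1 a d (cst a b d * z ^ b) (by positivity)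
    rw [show cst a b d * Bt a d * (z ^ b * (1 - z) ^ (a + d + 1)) =
      cst a b d * z ^ b * (Bt a d * (1 - z) ^ (a + d + 1)) by ring, ← this]
    congr 1
    ext x
    unfold jd
    by_cases hz : x ∈ Set.Ioo 0 (1 - z)
    · have : (x, x + z) ∈ tri := ⟨hz.1, by simpa using h0, by
        have := hz.2; simp only; linarith⟩
      rw [Set.indicator_of_mem hz, Set.indicator_of_mem this]
      congr 1; ring
    · have : (x, x + z) ∉ tri := fun h => hz ⟨h.1, by
        have := h.2.2; simp only at this; linarith⟩
      rw [Set.indicator_of_notMem hz, Set.indicator_of_notMem this]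
  · rw [bet, Set.indicator_of_notMem hx]
    simp only [jd]
    rw [lintegral_eq_zero_iff']
    · refine ae_of_all _ fun x => ?_
      have : (x, x + z) ∉ tri := fun h => hx (by
        obtain ⟨h1, h2, h3⟩ := h
        simp only at h1 h2 h3
        exact ⟨by linarith, by linarith⟩)
      exact Set.indicator_of_notMem this _
    · exact ((measurable_jd _ a b d).comp (by fun_prop : Measurable fun x => (x, x + z))).aemeasurable

lemma JL_lintegral (a b d : ℕ) (φ : ℝ × ℝ → ENNReal) (hφ : Measurable φ) :
    ∫⁻ z, φ z ∂(JL a b d) = ∫⁻ x, ∫⁻ y, jd (cst a b d) a b d (x, y) * φ (x, y) := by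
  have := measurable_jd (cst a b d) a b d
  rw [JL, lintegral_withDensity_eq_lintegral_mul _ this hφ, lintegral_prod]
  · rfl
  · fun_prop

lemma JL_fst (a b d : ℕ) :
    (JL a b d).map Prod.fst = volume.withDensity (bet a (b + d + 1)) := by
  refine Measure.ext_of_lintegral _ fun φ hφ => ?_
  have hm := measurable_jd (cst a b d) a b d
  rw [lintegral_map hφ measurable_fst, JL_lintegral _ _ _ _ (by fun_prop),
    lintegral_withDensity_eq_lintegral_mul _ (measurable_bet _ _) hφ]
  refine lintegral_congr fun x => ?_
  simp only []
  rw [lintegral_mul_const _ (by fun_prop), lint_fst]; rfl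

lemma JL_snd (a b d : ℕ) :
    (JL a b d).map Prod.snd = volume.withDensity (bet (a + b + 1) d) := by
  refine Measure.ext_of_lintegral _ fun φ hφ => ?_
  have hm := measurable_jd (cst a b d) a b d
  rw [lintegral_map hφ measurable_snd, JL_lintegral _ _ _ _ (by fun_prop),
    lintegral_withDensity_eq_lintegral_mul _ (measurable_bet _ _) hφ, lintegral_lintegral_swap]
  · refine lintegral_congr fun x => ?_
    change ∫⁻ w, jd (cst a b d) a b d (w, x) * φ x = _
    rw [lintegral_mul_const _ (by fun_prop), lint_snd]; rfl
  · fun_prop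

lemma JL_diff (a b d : ℕ) :
    (JL a b d).map (fun z => z.2 - z.1) = volume.withDensity (bet b (a + d + 1)) := by
  refine Measure.ext_of_lintegral _ fun φ hφ => ?_
  have hm := measurable_jd (cst a b d) a b d
  rw [lintegral_map hφ (by fun_prop), JL_lintegral _ _ _ _ (by fun_prop),
    lintegral_withDensity_eq_lintegral_mul _ (measurable_bet _ _) hφ]
  have : ∀ x : ℝ, ∫⁻ y, jd (cst a b d) a b d (x, y) * φ ((x, y).2 - (x, y).1) =
      ∫⁻ z, jd (cst a b d) a b d (x, x + z) * φ z := by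
    intro x
    rw [← lintegral_add_left_eq_self _ x]
    simp
  simp_rw [this]
  rw [lintegral_lintegral_swap]
  · refine lintegral_congr fun x => ?_
    rw [lintegral_mul_const _ (by fun_prop), lint_diff]; rfl
  · fun_prop

/-- density ratio -/
def rat (a b d : ℕ) : ℝ × ℝ → ENNReal := tri.indicator fun z =>
  ENNReal.ofReal (cst a b d * Bt a (b + d + 1) * Bt (a + b + 1) d *
    ((z.2 - z.1) ^ b / ((1 - z.1) ^ (b + d + 1) * z.2 ^ (a + b + 1))))

lemma measurable_rat (a b d : ℕ) : Measurable (rat a b d) := by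
  unfold rat
  exact Measurable.indicator (by fun_prop) measurableSet_tri

lemma JL_eq (a b d : ℕ) : JL a b d =
    ((volume.withDensity (bet a (b + d + 1))).prod
      (volume.withDensity (bet (a + b + 1) d))).withDensity (rat a b d) := by
  rw [prod_withDensity (measurable_bet _ _) (measurable_bet _ _), ← withDensity_mul, JL]
  · congr 1
    ext z
    simp only [Pi.mul_apply, jd, rat, bet]
    by_cases hz : z ∈ tri
    · obtain ⟨h1, h2, h3⟩ := id hz
      have h4 : 0 < z.2 := h1.trans h2
      have h5 : z.1 < 1 := h2.trans h3
      have h6 : 0 < 1 - z.1 := by linarith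
      have h7 : 0 < 1 - z.2 := by linarith
      have h8 : 0 < z.2 - z.1 := by linarith
      have b1 := Bt_pos a (b + d + 1)
      have b2 := Bt_pos (a + b + 1) d
      have b3 := cst_pos a b d
      rw [Set.indicator_of_mem hz, Set.indicator_of_mem hz, Set.indicator_of_mem (show z.1 ∈ Set.Ioo (0:ℝ) 1 from ⟨h1, h5⟩),
        Set.indicator_of_mem (show z.2 ∈ Set.Ioo (0:ℝ) 1 from ⟨h4, h3⟩), ← ENNReal.ofReal_mul (by positivity),
        ← ENNReal.ofReal_mul (by positivity)]
      congr 1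
      field_simp
    · rw [Set.indicator_of_notMem hz, Set.indicator_of_notMem hz, mul_zero]
  · have := measurable_bet a (b + d + 1)
    have := measurable_bet (a + b + 1) d
    fun_prop
  · exact measurable_rat a b d

lemma JL_ae_tri (a b d : ℕ) : ∀ᵐ z ∂(JL a b d), z ∈ tri := by
  rw [JL, ae_withDensity_iff (measurable_jd _ a b d)]
  refine ae_of_all _ fun z hz => ?_
  by_contra h
  exact hz (by rw [jd, Set.indicator_of_notMem h])

lemma bet_total (p q : ℕ) : volume.withDensity (bet p q) Set.univ = 1 := by
  rw [withDensity_apply _ MeasurableSet.univ, Measure.restrict_univ]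
  have h := beta_lintegral 1 one_pos p q (Bt p q)⁻¹ (by have := Bt_pos p q; positivity)
  unfold bet
  rw [h]
  have := (Bt_pos p q).ne'
  simp [this]

lemma JL_prob (a b d : ℕ) : IsProbabilityMeasure (JL a b d) := by
  constructor
  have h := bet_total a (b + d + 1)
  rw [← JL_fst, Measure.map_apply measurable_fst MeasurableSet.univ] at h
  simpa using h

lemma JL_kl (a b d : ℕ) :
    JL a b d ≪ ((JL a b d).map Prod.fst).prod ((JL a b d).map Prod.snd) ∧
    Integrable (llr (JL a b d) (((JL a b d).map Prod.fst).prod ((JL a b d).map Prod.snd)))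
      (JL a b d) ∧
    ∫ z, llr (JL a b d) (((JL a b d).map Prod.fst).prod ((JL a b d).map Prod.snd)) z ∂(JL a b d)
      = T (a + b + 1) + T (b + d + 1) - T b - T (a + b + d + 2) := by
  have hP := JL_prob a b d
  have hs : SigmaFinite (((JL a b d).map Prod.fst).prod ((JL a b d).map Prod.snd)) := by
    have := Measure.isProbabilityMeasure_map (μ := JL a b d) measurable_fst.aemeasurable
    have := Measure.isProbabilityMeasure_map (μ := JL a b d) measurable_snd.aemeasurable
    infer_instance
  set Q := ((JL a b d).map Prod.fst).prod ((JL a b d).map Prod.snd) with hQ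
  have hPQ : JL a b d = Q.withDensity (rat a b d) := by
    rw [hQ, JL_fst, JL_snd]; exact JL_eq a b d
  have hac : JL a b d ≪ Q := by rw [hPQ]; exact withDensity_absolutelyContinuous _ _
  have hrn : (JL a b d).rnDeriv Q =ᵐ[JL a b d] rat a b d := by
    apply hac.ae_le
    have := Measure.rnDeriv_withDensity Q (measurable_rat a b d)
    rwa [← hPQ] at this
  set K := cst a b d * Bt a (b + d + 1) * Bt (a + b + 1) d with hK
  have hKpos : 0 < K := mul_pos (mul_pos (cst_pos _ _ _) (Bt_pos _ _)) (Bt_pos _ _)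
  have hllr : llr (JL a b d) Q =ᵐ[JL a b d] fun z => Real.log K + b * Real.log (z.2 - z.1)
      - (b + d + 1 : ℕ) * Real.log (1 - z.1) - (a + b + 1 : ℕ) * Real.log z.2 := by
    filter_upwards [hrn, JL_ae_tri a b d] with z h1 hz
    obtain ⟨g1, g2, g3⟩ := id hz
    have h4 : 0 < z.2 := g1.trans g2
    have h6 : 0 < 1 - z.1 := by linarith
    have h8 : 0 < z.2 - z.1 := by linarith
    rw [llr, h1, rat, Set.indicator_of_mem hz, ← hK]
    clear_value K
    rw [ENNReal.toReal_ofReal (by positivity),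
      Real.log_mul hKpos.ne' (by positivity), Real.log_div (by positivity) (by positivity),
      Real.log_mul (by positivity) (by positivity), Real.log_pow, Real.log_pow, Real.log_pow]
    ring
  have i1 := bet_log b (a + d + 1)
  rw [← JL_diff, integrable_map_measure Real.measurable_log.aestronglyMeasurable (by fun_prop),
    integral_map (by fun_prop) Real.measurable_log.aestronglyMeasurable] at i1
  have i2 := bet_log' a (b + d + 1)
  have hl : Measurable fun z : ℝ => Real.log (1 - z) := by fun_prop
  rw [← JL_fst, integrable_map_measure hl.aestronglyMeasurable (by fun_prop),
    integral_map (by fun_prop) hl.aestronglyMeasurable] at i2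
  have i3 := bet_log (a + b + 1) d
  rw [← JL_snd, integrable_map_measure Real.measurable_log.aestronglyMeasurable (by fun_prop),
    integral_map (by fun_prop) Real.measurable_log.aestronglyMeasurable] at i3
  obtain ⟨i1, e1⟩ := i1
  obtain ⟨i2, e2⟩ := i2
  obtain ⟨i3, e3⟩ := i3
  simp only [Function.comp_def] at i1 i2 i3
  have I1 : Integrable (fun z => Real.log K + b * Real.log (z.2 - z.1)) (JL a b d) :=
    (integrable_const (Real.log K) (μ := JL a b d)).add (i1.const_mul (b : ℝ))
  have I2 : Integrable (fun z => Real.log K + b * Real.log (z.2 - z.1)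
      - (b + d + 1 : ℕ) * Real.log (1 - z.1)) (JL a b d) :=
    I1.sub (i2.const_mul ((b + d + 1 : ℕ) : ℝ))
  have I3 : Integrable (fun z => Real.log K + b * Real.log (z.2 - z.1)
      - (b + d + 1 : ℕ) * Real.log (1 - z.1) - (a + b + 1 : ℕ) * Real.log z.2) (JL a b d) :=
    I2.sub (i3.const_mul ((a + b + 1 : ℕ) : ℝ))
  refine ⟨hac, (integrable_congr hllr).2 I3, ?_⟩
  rw [integral_congr_ae hllr, integral_sub I2 (i3.const_mul _), integral_sub I1 (i2.const_mul _),
    integral_add (integrable_const _) (i1.const_mul _), integral_const_mul, integral_const_mul,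
    integral_const_mul, e1, e2, e3]
  have hK' : Real.log K = Real.log (b + d + 1).factorial + Real.log (a + b + 1).factorial
      - Real.log b.factorial - Real.log (a + b + d + 2).factorial := by
    have : K = ((b + d + 1).factorial * (a + b + 1).factorial : ℝ) /
        (b.factorial * (a + b + d + 2).factorial) := by
      rw [hK]
      unfold cst Bt
      rw [show a + (b + d + 1) + 1 = a + b + d + 2 by ring,
        show a + b + 1 + d + 1 = a + b + d + 2 by ring]
      field_simp
    rw [this, Real.log_div (by positivity) (by positivity), Real.log_mul (by positivity)
      (by positivity), Real.log_mul (by positivity) (by positivity)]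
    ring
  rw [show a + (b + d + 1) + 1 = a + b + d + 2 by ring,
        show a + b + 1 + d + 1 = a + b + d + 2 by ring,
        show b + (a + d + 1) + 1 = a + b + d + 2 by ring]
  simp only [integral_const, T]
  simp [hK']
  ring

lemma measurable_sortTuple {n : ℕ} (i : Fin n) :
    Measurable fun x : Fin n → ℝ => sortTuple x i := by
  refine measurable_of_Iic fun t => ?_
  have h : (fun x : Fin n → ℝ => sortTuple x i) ⁻¹' Set.Iic t =
      ⋃ σ : Equiv.Perm (Fin n), {x | Monotone (x ∘ σ)} ∩ {x | x (σ i) ≤ t} := by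
    ext x
    simp only [Set.mem_preimage, Set.mem_Iic, Set.mem_iUnion, Set.mem_inter_iff, Set.mem_ofPred_eq]
    constructor
    · intro h
      exact ⟨Tuple.sort x, Tuple.monotone_sort x, h⟩
    · rintro ⟨σ, h1, h2⟩
      have := congrFun (Tuple.unique_monotone (Tuple.monotone_sort x) h1) i
      unfold sortTuple
      rw [this]
      exact h2
  rw [h]
  refine MeasurableSet.iUnion fun σ => MeasurableSet.inter ?_ ?_
  · have : {x : Fin n → ℝ | Monotone (x ∘ σ)} =
        ⋂ k : Fin n, ⋂ l : Fin n, ⋂ _ : k ≤ l, {x | x (σ k) ≤ x (σ l)} := by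
      ext x; simp [Monotone]
    rw [this]
    refine MeasurableSet.iInter fun k => MeasurableSet.iInter fun l => MeasurableSet.iInter fun _ =>
      measurableSet_le (measurable_pi_apply _) (measurable_pi_apply _)
  · exact measurableSet_le (measurable_pi_apply _) measurable_const

/-- Configurations where the coordinates `i`, `j` separate the others as in a sorted tuple. -/
def Gp {n : ℕ} {α : Type*} [LinearOrder α] (i j : Fin n) (x : Fin n → α) : Prop :=
  x i < x j ∧ (∀ k, k < i → x k < x i) ∧ (∀ k, i < k → k < j → x i < x k ∧ x k < x j) ∧
    (∀ k, j < k → x j < x k)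

lemma measurableSet_Gp {n : ℕ} (i j : Fin n) : MeasurableSet {x : Fin n → ℝ | Gp i j x} := by
  have : {x : Fin n → ℝ | Gp i j x} = {x | x i < x j} ∩ ((⋂ k, ⋂ _ : k < i, {x | x k < x i}) ∩
      ((⋂ k, ⋂ _ : i < k, ⋂ _ : k < j, ({x | x i < x k} ∩ {x | x k < x j})) ∩
        (⋂ k, ⋂ _ : j < k, {x | x j < x k}))) := by
    ext x; simp [Gp]
  have h : ∀ k l : Fin n, MeasurableSet {x : Fin n → ℝ | x k < x l} := fun k l =>
    measurableSet_lt (measurable_pi_apply _) (measurable_pi_apply _)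
  rw [this]
  refine (h _ _).inter ((MeasurableSet.iInter fun k => MeasurableSet.iInter fun _ => h _ _).inter
    ((MeasurableSet.iInter fun k => MeasurableSet.iInter fun _ => MeasurableSet.iInter fun _ =>
      (h _ _).inter (h _ _)).inter (MeasurableSet.iInter fun k => MeasurableSet.iInter fun _ =>
        h _ _)))

lemma perm_fix {n : ℕ} (τ : Equiv.Perm (Fin n)) (i : Fin n) (h1 : ∀ k, k < i → τ k < τ i)
    (h2 : ∀ k, i < k → τ i < τ k) : τ i = i := by
  have c1 : ((Finset.Iio i).image τ).card ≤ (Finset.Iio (τ i)).card := by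
    refine Finset.card_le_card fun y hy => ?_
    obtain ⟨k, hk, rfl⟩ := Finset.mem_image.1 hy
    exact Finset.mem_Iio.2 (h1 k (Finset.mem_Iio.1 hk))
  have c2 : ((Finset.Ioi i).image τ).card ≤ (Finset.Ioi (τ i)).card := by
    refine Finset.card_le_card fun y hy => ?_
    obtain ⟨k, hk, rfl⟩ := Finset.mem_image.1 hy
    exact Finset.mem_Ioi.2 (h2 k (Finset.mem_Ioi.1 hk))
  rw [Finset.card_image_of_injective _ τ.injective, Fin.card_Iio, Fin.card_Iio] at c1
  rw [Finset.card_image_of_injective _ τ.injective, Fin.card_Ioi, Fin.card_Ioi] at c2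
  apply Fin.ext
  have := (τ i).isLt
  omega

lemma Gp_fix {n : ℕ} {i j : Fin n} (hij : i < j) (τ : Equiv.Perm (Fin n)) (h : Gp i j τ) :
    τ i = i ∧ τ j = j := by
  obtain ⟨h0, h1, h2, h3⟩ := h
  constructor
  · refine perm_fix τ i h1 fun k hk => ?_
    rcases lt_trichotomy k j with h | rfl | h
    · exact (h2 k hk h).1
    · exact h0
    · exact h0.trans (h3 k h)
  · refine perm_fix τ j (fun k hk => ?_) h3
    rcases lt_trichotomy k i with h | rfl | h
    · exact (h1 k h).trans h0
    · exact h0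
    · exact (h2 k h hk).2

lemma Gp_comp {n : ℕ} {α β : Type*} [LinearOrder α] [LinearOrder β] (i j : Fin n)
    (x : Fin n → α) (y : α → β) (hy : StrictMono y) : Gp i j (y ∘ x) ↔ Gp i j x := by
  simp [Gp, hy.lt_iff_lt]

/-- The event used in the symmetrisation. -/
def Ev {n : ℕ} (i j : Fin n) (S : Set (ℝ × ℝ)) : Set (Fin n → ℝ) :=
  {x | Gp i j x} ∩ {x | (x i, x j) ∈ S}

lemma measurableSet_Ev {n : ℕ} (i j : Fin n) (S : Set (ℝ × ℝ)) (hS : MeasurableSet S) :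
    MeasurableSet (Ev i j S) :=
  (measurableSet_Gp i j).inter (hS.preimage (by fun_prop : Measurable fun x : Fin n → ℝ => (x i, x j)))

/-- number of good permutations -/
def Kc {n : ℕ} (i j : Fin n) : ENNReal :=
  ∑ τ : Equiv.Perm (Fin n), if Gp i j τ then 1 else 0

lemma sum_perm {n : ℕ} {i j : Fin n} (hij : i < j) (S : Set (ℝ × ℝ)) (x : Fin n → ℝ)
    (hx : Function.Injective x) :
    ∑ σ : Equiv.Perm (Fin n), (Ev i j S).indicator (1 : (Fin n → ℝ) → ENNReal) (x ∘ σ) =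
      Kc i j * S.indicator (1 : ℝ × ℝ → ENNReal) (sortTuple x i, sortTuple x j) := by
  rw [← Equiv.sum_comp (Equiv.mulLeft (Tuple.sort x)), Kc, Finset.sum_mul]
  refine Finset.sum_congr rfl fun τ _ => ?_
  have hy : StrictMono (sortTuple x) :=
    (Tuple.monotone_sort x).strictMono_of_injective (hx.comp (Tuple.sort x).injective)
  have e : x ∘ (Equiv.mulLeft (Tuple.sort x) τ) = sortTuple x ∘ τ := rfl
  rw [e]
  by_cases hG : Gp i j τ
  · obtain ⟨f1, f2⟩ := Gp_fix hij τ hG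
    rw [if_pos hG, one_mul]
    have hG' := (Gp_comp i j τ (sortTuple x) hy).2 hG
    simp [Set.indicator, Ev, hG', f1, f2]
  · have hG' := fun h => hG ((Gp_comp i j τ (sortTuple x) hy).1 h)
    rw [if_neg hG, zero_mul]
    exact Set.indicator_of_notMem (fun h => hG' h.1) _

instance sampleLaw_prob (n : ℕ) (μ : Measure ℝ) [IsProbabilityMeasure μ] :
    IsProbabilityMeasure (sampleLaw n μ) := by unfold sampleLaw; infer_instance

lemma ae_inj (n : ℕ) : ∀ᵐ x ∂(sampleLaw n unif), Function.Injective x := by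
  have hv : sampleLaw n unif ≪ (volume : Measure (Fin n → ℝ)) := by
    unfold sampleLaw unif
    rw [← Measure.restrict_pi_pi]
    exact Measure.absolutelyContinuous_of_le Measure.restrict_le_self
  apply hv.ae_le
  have : ∀ k l : Fin n, k ≠ l → ∀ᵐ x : Fin n → ℝ, x k ≠ x l := by
    intro k l hkl
    let s : Submodule ℝ (Fin n → ℝ) := LinearMap.ker
      (LinearMap.proj (R := ℝ) (φ := fun _ : Fin n => ℝ) k - LinearMap.proj l)
    have hs : s ≠ ⊤ := by
      intro h
      have : (Pi.single k 1 : Fin n → ℝ) ∈ s := by rw [h]; trivial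
      simp [s, hkl] at this
    have := Measure.addHaar_submodule (volume : Measure (Fin n → ℝ)) s hs
    rw [ae_iff]
    convert this using 2
    ext x
    simp [s, sub_eq_zero]
  have h2 : ∀ᵐ x : Fin n → ℝ, ∀ k l : Fin n, k ≠ l → x k ≠ x l := by
    rw [ae_all_iff]; intro k
    rw [ae_all_iff]; intro l
    by_cases h : k = l
    · simp [h]
    · filter_upwards [this k l h] with x hx _ using hx
  filter_upwards [h2] with x hx k l hkl
  by_contra h
  exact hx k l h hkl

lemma perm_pres (n : ℕ) (σ : Equiv.Perm (Fin n)) :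
    MeasurePreserving (fun x : Fin n → ℝ => x ∘ σ) (sampleLaw n unif) (sampleLaw n unif) := by
  unfold sampleLaw
  have := measurePreserving_piCongrLeft (α := fun _ : Fin n => ℝ) (fun _ : Fin n => unif) σ.symm
  convert this using 1
  ext x k
  obtain ⟨k, rfl⟩ := σ.symm.surjective k
  simp [MeasurableEquiv.piCongrLeft, Equiv.piCongrLeft_apply_apply]

lemma joint_sym {n : ℕ} {i j : Fin n} (hij : i < j) (S : Set (ℝ × ℝ)) (hS : MeasurableSet S) :
    Kc i j * ((sampleLaw n unif).map fun x => (sortTuple x i, sortTuple x j)) S =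
      (n.factorial : ENNReal) * sampleLaw n unif (Ev i j S) := by
  have hE := measurableSet_Ev i j S hS
  have hp : Measurable fun x : Fin n → ℝ => (sortTuple x i, sortTuple x j) :=
    (measurable_sortTuple i).prodMk (measurable_sortTuple j)
  have h1 : ∫⁻ x, ∑ σ : Equiv.Perm (Fin n),
      (Ev i j S).indicator (1 : (Fin n → ℝ) → ENNReal) (x ∘ σ) ∂(sampleLaw n unif) =
      (n.factorial : ENNReal) * sampleLaw n unif (Ev i j S) := by
    rw [lintegral_finsetSum]
    · have : ∀ σ : Equiv.Perm (Fin n), ∫⁻ x,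
          (Ev i j S).indicator (1 : (Fin n → ℝ) → ENNReal) (x ∘ σ) ∂(sampleLaw n unif) =
          sampleLaw n unif (Ev i j S) := by
        intro σ
        rw [(perm_pres n σ).lintegral_comp (f := (Ev i j S).indicator (1 : (Fin n → ℝ) → ENNReal))
          (measurable_one.indicator hE), lintegral_indicator_one hE]
      simp_rw [this]
      simp [Fintype.card_perm]
    · intro σ _
      exact (measurable_one.indicator hE).comp (perm_pres n σ).measurable
  rw [← h1, lintegral_congr_ae ((ae_inj n).mono fun x hx => sum_perm hij S x hx),
    lintegral_const_mul, ← lintegral_indicator_one hS, lintegral_map (measurable_one.indicator hS) hp]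
  exact (measurable_one.indicator hS).comp hp

/-- Interval for the `k`-th coordinate. -/
def Ik {n : ℕ} (i j k : Fin n) (u v : ℝ) : Set ℝ :=
  if k < i then Set.Iio u else if k < j then Set.Ioo u v else Set.Ioi v

lemma measurableSet_Ik {n : ℕ} (i j k : Fin n) (u v : ℝ) : MeasurableSet (Ik i j k u v) := by
  unfold Ik
  split_ifs
  · exact measurableSet_Iio
  · exact measurableSet_Ioo
  · exact measurableSet_Ioi

lemma unif_Iio {u v : ℝ} (h : (u, v) ∈ tri) : unif (Set.Iio u) = ENNReal.ofReal u := by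
  obtain ⟨h1, h2, h3⟩ := h
  simp only at h1 h2 h3
  have : Set.Iio u ∩ Set.Ioo 0 1 = Set.Ioo 0 u := by
    ext z; simp only [Set.mem_inter_iff, Set.mem_Iio, Set.mem_Ioo]
    constructor
    · rintro ⟨a, b, c⟩; exact ⟨b, a⟩
    · rintro ⟨a, b⟩; exact ⟨b, a, by linarith⟩
  rw [unif, Measure.restrict_apply measurableSet_Iio, this, Real.volume_Ioo, sub_zero]

lemma unif_Ioo {u v : ℝ} (h : (u, v) ∈ tri) : unif (Set.Ioo u v) = ENNReal.ofReal (v - u) := by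
  obtain ⟨h1, h2, h3⟩ := h
  simp only at h1 h2 h3
  have : Set.Ioo u v ∩ Set.Ioo 0 1 = Set.Ioo u v := by
    ext z; simp only [Set.mem_inter_iff, Set.mem_Ioo]
    constructor
    · rintro ⟨a, b⟩; exact a
    · rintro ⟨a, b⟩; exact ⟨⟨a, b⟩, by linarith, by linarith⟩
  rw [unif, Measure.restrict_apply measurableSet_Ioo, this, Real.volume_Ioo]

lemma unif_Ioi {u v : ℝ} (h : (u, v) ∈ tri) : unif (Set.Ioi v) = ENNReal.ofReal (1 - v) := by
  obtain ⟨h1, h2, h3⟩ := h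
  simp only at h1 h2 h3
  have : Set.Ioi v ∩ Set.Ioo 0 1 = Set.Ioo v 1 := by
    ext z; simp only [Set.mem_inter_iff, Set.mem_Ioi, Set.mem_Ioo]
    constructor
    · rintro ⟨a, b, c⟩; exact ⟨a, c⟩
    · rintro ⟨a, b⟩; exact ⟨a, by linarith, b⟩
  rw [unif, Measure.restrict_apply measurableSet_Ioi, this, Real.volume_Ioo]

lemma prod_Ik {n a b d : ℕ} {i j : Fin n} (hi : (i : ℕ) = a) (hj : (j : ℕ) = a + b + 1)
    (hn : n = a + b + d + 2) {u v : ℝ} (h : (u, v) ∈ tri) :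
    ∏ k ∈ (Finset.univ.erase i).erase j, unif (Ik i j k u v) = jd 1 a b d (u, v) := by
  have hij : i < j := by rw [Fin.lt_def]; omega
  have hR : (Finset.univ.erase i).erase j =
      (Finset.Iio i ∪ Finset.Ioo i j) ∪ Finset.Ioi j := by
    ext k
    simp only [Finset.mem_erase, Finset.mem_univ, and_true, Finset.mem_union, Finset.mem_Iio,
      Finset.mem_Ioo, Finset.mem_Ioi, ne_eq, Fin.ext_iff, Fin.lt_def] at hij ⊢
    omega
  have d1 : Disjoint (Finset.Iio i) (Finset.Ioo i j) := by
    rw [Finset.disjoint_left]; intro k h1 h2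
    exact absurd (Finset.mem_Iio.1 h1) (not_lt.2 (Finset.mem_Ioo.1 h2).1.le)
  have d2 : Disjoint (Finset.Iio i ∪ Finset.Ioo i j) (Finset.Ioi j) := by
    rw [Finset.disjoint_left]; intro k h1 h2
    have h2 := Finset.mem_Ioi.1 h2
    rcases Finset.mem_union.1 h1 with h1 | h1
    · exact absurd ((Finset.mem_Iio.1 h1).trans hij) (not_lt.2 h2.le)
    · exact absurd (Finset.mem_Ioo.1 h1).2 (not_lt.2 h2.le)
  rw [hR, Finset.prod_union d2, Finset.prod_union d1]
  have p1 : ∏ k ∈ Finset.Iio i, unif (Ik i j k u v) = ENNReal.ofReal u ^ a := by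
    rw [Finset.prod_congr rfl (g := fun _ => ENNReal.ofReal u), Finset.prod_const, Fin.card_Iio, hi]
    intro k hk
    rw [Ik, if_pos (Finset.mem_Iio.1 hk), unif_Iio h]
  have p2 : ∏ k ∈ Finset.Ioo i j, unif (Ik i j k u v) = ENNReal.ofReal (v - u) ^ b := by
    rw [Finset.prod_congr rfl (g := fun _ => ENNReal.ofReal (v - u)), Finset.prod_const,
      Fin.card_Ioo, hi, hj]
    · congr 1; omega
    intro k hk
    have hk := Finset.mem_Ioo.1 hk
    rw [Ik, if_neg (not_lt.2 hk.1.le), if_pos hk.2, unif_Ioo h]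
  have p3 : ∏ k ∈ Finset.Ioi j, unif (Ik i j k u v) = ENNReal.ofReal (1 - v) ^ d := by
    rw [Finset.prod_congr rfl (g := fun _ => ENNReal.ofReal (1 - v)), Finset.prod_const,
      Fin.card_Ioi, hj]
    · congr 1; omega
    intro k hk
    have hk := Finset.mem_Ioi.1 hk
    rw [Ik, if_neg (not_lt.2 (hij.trans hk).le), if_neg (not_lt.2 hk.le), unif_Ioi h]
  rw [p1, p2, p3, jd, Set.indicator_of_mem h]
  obtain ⟨h1, h2, h3⟩ := h
  simp only at h1 h2 h3 ⊢
  have g2 : 0 ≤ v - u := by linarith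
  have g3 : 0 ≤ 1 - v := by linarith
  rw [one_mul, ENNReal.ofReal_mul (by positivity), ENNReal.ofReal_mul (by positivity),
    ENNReal.ofReal_pow h1.le, ENNReal.ofReal_pow g2, ENNReal.ofReal_pow g3]

lemma marg {n a b d : ℕ} {i j : Fin n} (hi : (i : ℕ) = a) (hj : (j : ℕ) = a + b + 1)
    (hn : n = a + b + d + 2) (S : Set (ℝ × ℝ)) {u v : ℝ}
    (hu : u ∈ Set.Ioo (0:ℝ) 1) (hv : v ∈ Set.Ioo (0:ℝ) 1) :
    (∫⋯∫⁻_(Finset.univ.erase i).erase j, (Ev i j S).indicator (1 : (Fin n → ℝ) → ENNReal)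
      ∂(fun _ => unif)) (Function.update (Function.update 0 i u) j v) =
      S.indicator (jd 1 a b d) (u, v) := by
  have hij : i < j := by rw [Fin.lt_def]; omega
  rw [lmarginal]
  set R := (Finset.univ.erase i).erase j with hR
  have hiR : i ∉ R := by simp [hR]
  have hjR : j ∉ R := by simp [hR]
  have hmem : ∀ k, k ≠ i → k ≠ j → k ∈ R := fun k h1 h2 => by simp [hR, h1, h2]
  have key : ∀ y : R → ℝ, (Ev i j S).indicator (1 : (Fin n → ℝ) → ENNReal)
      (Function.updateFinset (Function.update (Function.update 0 i u) j v) R y) =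
      (S ∩ {z | z.1 < z.2}).indicator 1 (u, v) *
        (Set.univ.pi fun k : R => Ik i j k.1 u v).indicator 1 y := by
    intro y
    set w := Function.updateFinset (Function.update (Function.update (0 : Fin n → ℝ) i u) j v) R y
      with hw
    have wi : w i = u := by simp [hw, Function.updateFinset, hiR, hij.ne]
    have wj : w j = v := by simp [hw, Function.updateFinset, hjR]
    have wk : ∀ k : R, w k.1 = y k := fun k => by simp [hw, Function.updateFinset]
    have hiff : w ∈ Ev i j S ↔ (u, v) ∈ S ∩ {z | z.1 < z.2} ∧
        y ∈ (Set.univ.pi fun k : R => Ik i j k.1 u v) := by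
      constructor
      · rintro ⟨⟨g0, g1, g2, g3⟩, hS⟩
        rw [wi, wj] at g0
        change (w i, w j) ∈ S at hS
        rw [wi, wj] at hS
        refine ⟨⟨hS, g0⟩, fun k _ => ?_⟩
        rw [← wk k]
        have hki : k.1 ≠ i := fun h => hiR (h ▸ k.2)
        have hkj : k.1 ≠ j := fun h => hjR (h ▸ k.2)
        change w k.1 ∈ Ik i j k.1 u v
        unfold Ik
        rw [wi] at g1 g2
        rw [wj] at g2 g3
        split_ifs with c1 c2
        · exact g1 _ c1
        · exact g2 _ (lt_of_le_of_ne (not_lt.1 c1) hki.symm) c2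
        · exact g3 _ (lt_of_le_of_ne (not_lt.1 c2) hkj.symm)
      · rintro ⟨⟨hS, g0⟩, hy⟩
        have hy' : ∀ k, k ≠ i → k ≠ j → w k ∈ Ik i j k u v := fun k h1 h2 => by
          have := hy ⟨k, hmem k h1 h2⟩ (Set.mem_univ _)
          rw [← wk] at this
          exact this
        refine ⟨⟨by rw [wi, wj]; exact g0, fun k hk => ?_, fun k hk1 hk2 => ?_, fun k hk => ?_⟩, ?_⟩
        · have := hy' k hk.ne (hk.trans hij).ne
          rw [Ik, if_pos hk] at this
          rw [wi]; exact this
        · have := hy' k hk1.ne' hk2.ne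
          rw [Ik, if_neg (not_lt.2 hk1.le), if_pos hk2] at this
          rw [wi, wj]; exact this
        · have := hy' k (hij.trans hk).ne' hk.ne'
          rw [Ik, if_neg (not_lt.2 (hij.trans hk).le), if_neg (not_lt.2 hk.le)] at this
          rw [wj]; exact this
        · change (w i, w j) ∈ S
          rw [wi, wj]; exact hS
    by_cases c1 : (u, v) ∈ S ∩ {z | z.1 < z.2}
    · by_cases c2 : y ∈ (Set.univ.pi fun k : R => Ik i j k.1 u v)
      · rw [Set.indicator_of_mem c1, Set.indicator_of_mem c2, Set.indicator_of_mem (hiff.2 ⟨c1, c2⟩)]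
        simp
      · rw [Set.indicator_of_notMem c2, Set.indicator_of_notMem (fun h => c2 (hiff.1 h).2), mul_zero]
    · rw [Set.indicator_of_notMem c1, Set.indicator_of_notMem (fun h => c1 (hiff.1 h).1), zero_mul]
  simp_rw [key]
  have hmp : MeasurableSet (Set.univ.pi fun k : R => Ik i j k.1 u v) :=
    MeasurableSet.univ_pi fun k => measurableSet_Ik _ _ _ _ _
  rw [lintegral_const_mul _ (measurable_one.indicator hmp), lintegral_indicator_one hmp,
    Measure.pi_pi, Finset.prod_coe_sort R (fun k => unif (Ik i j k u v))]
  by_cases huv : u < v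
  · have ht : (u, v) ∈ tri := ⟨hu.1, huv, hv.2⟩
    rw [prod_Ik hi hj hn ht]
    by_cases hS : (u, v) ∈ S
    · rw [Set.indicator_of_mem hS, Set.indicator_of_mem (show (u, v) ∈ S ∩ {z : ℝ × ℝ | z.1 < z.2} from ⟨hS, huv⟩)]; simp
    · rw [Set.indicator_of_notMem hS, Set.indicator_of_notMem (show (u, v) ∉ S ∩ {z : ℝ × ℝ | z.1 < z.2} from fun h => hS h.1), zero_mul]
  · rw [Set.indicator_of_notMem (show (u, v) ∉ S ∩ {z : ℝ × ℝ | z.1 < z.2} from fun h => huv h.2), zero_mul]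
    have : jd 1 a b d (u, v) = 0 := Set.indicator_of_notMem (fun h => huv h.2.1) _
    simp [Set.indicator, this]

lemma sample_Ev {n a b d : ℕ} {i j : Fin n} (hi : (i : ℕ) = a) (hj : (j : ℕ) = a + b + 1)
    (hn : n = a + b + d + 2) (S : Set (ℝ × ℝ)) (hS : MeasurableSet S) :
    sampleLaw n unif (Ev i j S) = (volume.prod volume).withDensity (jd 1 a b d) S := by
  have hij : i < j := by rw [Fin.lt_def]; omega
  have hE := measurableSet_Ev i j S hS
  have hm := measurable_jd 1 a b d
  rw [← lintegral_indicator_one hE, sampleLaw, lintegral_eq_lmarginal_univ 0,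
    lmarginal_erase _ (measurable_one.indicator hE) (Finset.mem_univ i), withDensity_apply _ hS,
    ← lintegral_indicator hS, lintegral_prod _ (hm.indicator hS).aemeasurable]
  have hji : j ∈ Finset.univ.erase i := by simp [hij.ne']
  have e1 : ∀ u : ℝ, (∫⋯∫⁻_Finset.univ.erase i, (Ev i j S).indicator
      (1 : (Fin n → ℝ) → ENNReal) ∂(fun _ => unif)) (Function.update 0 i u) =
      ∫⁻ v, (∫⋯∫⁻_(Finset.univ.erase i).erase j, (Ev i j S).indicator
      (1 : (Fin n → ℝ) → ENNReal) ∂(fun _ => unif))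
        (Function.update (Function.update 0 i u) j v) ∂unif := fun u =>
    lmarginal_erase _ (measurable_one.indicator hE) hji _
  simp_rw [e1]
  have e2 : ∀ u : ℝ, u ∈ Set.Ioo (0:ℝ) 1 →
      ∫⁻ v, (∫⋯∫⁻_(Finset.univ.erase i).erase j, (Ev i j S).indicator
      (1 : (Fin n → ℝ) → ENNReal) ∂(fun _ => unif))
        (Function.update (Function.update 0 i u) j v) ∂unif =
      ∫⁻ v, S.indicator (jd 1 a b d) (u, v) := by
    intro u hu
    have : ∫⁻ v, S.indicator (jd 1 a b d) (u, v) =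
        ∫⁻ v in Set.Ioo (0:ℝ) 1, S.indicator (jd 1 a b d) (u, v) := by
      rw [← lintegral_indicator measurableSet_Ioo]
      refine lintegral_congr fun v => ?_
      by_cases hv : v ∈ Set.Ioo (0:ℝ) 1
      · rw [Set.indicator_of_mem hv]
      · rw [Set.indicator_of_notMem hv]
        have : jd 1 a b d (u, v) = 0 :=
          Set.indicator_of_notMem (fun h => hv ⟨h.1.trans h.2.1, h.2.2⟩) _
        simp [Set.indicator, this]
    rw [this, unif]
    exact setLIntegral_congr_fun measurableSet_Ioo fun v hv => marg hi hj hn S hu hv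
  have e3 : ∫⁻ u, ∫⁻ v, S.indicator (jd 1 a b d) (u, v) =
      ∫⁻ u in Set.Ioo (0:ℝ) 1, ∫⁻ v, S.indicator (jd 1 a b d) (u, v) := by
    rw [← lintegral_indicator measurableSet_Ioo]
    refine lintegral_congr fun u => ?_
    by_cases hv : u ∈ Set.Ioo (0:ℝ) 1
    · rw [Set.indicator_of_mem hv]
    · rw [Set.indicator_of_notMem hv]
      have : ∀ v, S.indicator (jd 1 a b d) (u, v) = 0 := fun v => by
        have : jd 1 a b d (u, v) = 0 :=
          Set.indicator_of_notMem (fun h => hv ⟨h.1, h.2.1.trans h.2.2⟩) _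
        simp [Set.indicator, this]
      simp [this]
  rw [e3]
  conv_lhs => rw [unif]
  exact setLIntegral_congr_fun measurableSet_Ioo fun u hu => e2 u hu

lemma joint_eq_s18 {n a b d : ℕ} {i j : Fin n} (hi : (i : ℕ) = a) (hj : (j : ℕ) = a + b + 1)
    (hn : n = a + b + d + 2) :
    ((sampleLaw n unif).map fun x => (sortTuple x i, sortTuple x j)) = JL a b d := by
  have hij : i < j := by rw [Fin.lt_def]; omega
  have hp : Measurable fun x : Fin n → ℝ => (sortTuple x i, sortTuple x j) :=
    (measurable_sortTuple i).prodMk (measurable_sortTuple j)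
  have hPr : IsProbabilityMeasure
      ((sampleLaw n unif).map fun x => (sortTuple x i, sortTuple x j)) :=
    Measure.isProbabilityMeasure_map hp.aemeasurable
  have hJ := JL_prob a b d
  set M := ((volume : Measure ℝ).prod (volume : Measure ℝ)).withDensity (jd 1 a b d) with hM
  have h1 : ∀ S, MeasurableSet S →
      Kc i j * ((sampleLaw n unif).map fun x => (sortTuple x i, sortTuple x j)) S =
      (n.factorial : ENNReal) * M S := fun S hS => by
    rw [joint_sym hij S hS, sample_Ev hi hj hn S hS]
  have h2 : JL a b d = ENNReal.ofReal (cst a b d) • M := by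
    rw [hM, ← withDensity_smul _ (measurable_jd 1 a b d), JL]
    congr 1
    ext z
    simp only [Pi.smul_apply, smul_eq_mul, jd]
    by_cases hz : z ∈ tri
    · rw [Set.indicator_of_mem hz, Set.indicator_of_mem hz,
        ← ENNReal.ofReal_mul (cst_pos _ _ _).le, one_mul]
    · rw [Set.indicator_of_notMem hz, Set.indicator_of_notMem hz, mul_zero]
  have hK := h1 Set.univ MeasurableSet.univ
  rw [measure_univ, mul_one] at hK
  have hC : ENNReal.ofReal (cst a b d) * M Set.univ = 1 := by
    have : (JL a b d) Set.univ = 1 := measure_univ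
    rwa [h2, Measure.smul_apply, smul_eq_mul] at this
  ext S hS
  have h3 := h1 S hS
  rw [hK, mul_assoc] at h3
  have h4 := (ENNReal.mul_right_inj (by positivity) (ENNReal.natCast_ne_top _)).1 h3
  rw [h2, Measure.smul_apply, smul_eq_mul, ← h4, ← mul_assoc, hC, one_mul]


/-- Quantile function. -/
def qtl (μ : Measure ℝ) (u : ℝ) : ℝ :=
  if u ∈ Set.Ioo (0:ℝ) 1 then sInf {x | u ≤ ProbabilityTheory.cdf μ x} else 0

lemma qtl_le_iff (μ : Measure ℝ) [IsProbabilityMeasure μ] {u : ℝ} (hu : u ∈ Set.Ioo (0:ℝ) 1)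
    (x : ℝ) : qtl μ u ≤ x ↔ u ≤ ProbabilityTheory.cdf μ x := by
  have hmono := ProbabilityTheory.monotone_cdf μ
  have hne : {x | u ≤ ProbabilityTheory.cdf μ x}.Nonempty := by
    obtain ⟨y, hy⟩ := ((ProbabilityTheory.tendsto_cdf_atTop μ).eventually
      (eventually_gt_nhds hu.2)).exists
    exact ⟨y, hy.le⟩
  have hbd : BddBelow {x | u ≤ ProbabilityTheory.cdf μ x} := by
    obtain ⟨y, hy⟩ := ((ProbabilityTheory.tendsto_cdf_atBot μ).eventually
      (eventually_lt_nhds hu.1)).exists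
    refine ⟨y, fun z hz => ?_⟩
    by_contra h
    have h1 : u ≤ ProbabilityTheory.cdf μ z := hz
    have h2 := hmono (not_le.1 h).le
    linarith
  rw [qtl, if_pos hu]
  constructor
  · intro h
    have hgt : ∀ y, x < y → u ≤ ProbabilityTheory.cdf μ y := by
      intro y hy
      obtain ⟨z, hz, hzy⟩ := exists_lt_of_csInf_lt hne (lt_of_le_of_lt h hy)
      exact le_trans hz (hmono hzy.le)
    have hr : Tendsto (ProbabilityTheory.cdf μ) (𝓝[>] x) (𝓝 (ProbabilityTheory.cdf μ x)) :=
      ((ProbabilityTheory.cdf μ).right_continuous x).mono Set.Ioi_subset_Ici_self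
    exact ge_of_tendsto hr (eventually_mem_nhdsWithin.mono fun y hy => hgt y hy)
  · intro h
    exact csInf_le hbd h

lemma qtl_preimage (μ : Measure ℝ) [IsProbabilityMeasure μ] (x : ℝ) :
    qtl μ ⁻¹' Set.Iic x ∩ Set.Ioo 0 1 =
      Set.Iic (ProbabilityTheory.cdf μ x) ∩ Set.Ioo 0 1 := by
  ext u
  constructor
  · rintro ⟨h1, h2⟩; exact ⟨(qtl_le_iff μ h2 x).1 h1, h2⟩
  · rintro ⟨h1, h2⟩; exact ⟨(qtl_le_iff μ h2 x).2 h1, h2⟩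

lemma measurable_qtl (μ : Measure ℝ) [IsProbabilityMeasure μ] : Measurable (qtl μ) := by
  refine measurable_of_Iic fun x => ?_
  have : qtl μ ⁻¹' Set.Iic x = (qtl μ ⁻¹' Set.Iic x ∩ Set.Ioo 0 1) ∪
      (if (0:ℝ) ≤ x then (Set.Ioo (0:ℝ) 1)ᶜ else ∅) := by
    ext u
    by_cases hu : u ∈ Set.Ioo (0:ℝ) 1
    · by_cases hx : (0:ℝ) ≤ x
      · rw [if_pos hx]
        constructor
        · intro h; exact Or.inl ⟨h, hu⟩
        · rintro (h | h)
          · exact h.1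
          · exact absurd hu h
      · rw [if_neg hx, Set.union_empty]
        exact ⟨fun h => ⟨h, hu⟩, fun h => h.1⟩
    · have h0 : qtl μ u = 0 := if_neg hu
      by_cases hx : (0:ℝ) ≤ x
      · rw [if_pos hx]
        refine ⟨fun _ => Or.inr hu, fun _ => ?_⟩
        change qtl μ u ≤ x
        rw [h0]; exact hx
      · rw [if_neg hx, Set.union_empty]
        refine ⟨fun h => ?_, fun h => h.1⟩
        change qtl μ u ≤ x at h
        rw [h0] at h; exact absurd h hx
  rw [this, qtl_preimage]
  refine (measurableSet_Iic.inter measurableSet_Ioo).union ?_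
  split_ifs
  · exact measurableSet_Ioo.compl
  · exact MeasurableSet.empty

lemma qtl_mono (μ : Measure ℝ) [IsProbabilityMeasure μ] {u v : ℝ} (hu : u ∈ Set.Ioo (0:ℝ) 1)
    (hv : v ∈ Set.Ioo (0:ℝ) 1) (h : u ≤ v) : qtl μ u ≤ qtl μ v :=
  (qtl_le_iff μ hu _).2 (h.trans ((qtl_le_iff μ hv _).1 le_rfl))

lemma map_qtl (μ : Measure ℝ) [IsProbabilityMeasure μ] : unif.map (qtl μ) = μ := by
  have hq := measurable_qtl μ
  haveI : IsProbabilityMeasure (unif.map (qtl μ)) :=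
    Measure.isProbabilityMeasure_map hq.aemeasurable
  refine Measure.ext_of_Iic _ _ fun x => ?_
  rw [Measure.map_apply hq measurableSet_Iic, unif,
    Measure.restrict_apply (hq measurableSet_Iic), qtl_preimage, ← ProbabilityTheory.ofReal_cdf]
  have h0 := ProbabilityTheory.cdf_nonneg μ x
  have h1 := ProbabilityTheory.cdf_le_one μ x
  generalize ProbabilityTheory.cdf μ x = c at *
  apply le_antisymm
  · refine (measure_mono (t := Set.Ioc 0 c) fun u hu => ⟨hu.2.1, hu.1⟩).trans ?_
    rw [Real.volume_Ioc, sub_zero]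
  · refine le_trans ?_ (measure_mono (s := Set.Ioo 0 c)
      fun u hu => ⟨hu.2.le, hu.1, hu.2.trans_le h1⟩)
    rw [Real.volume_Ioo, sub_zero]

lemma sampleLaw_map (n : ℕ) (μ : Measure ℝ) [IsProbabilityMeasure μ] :
    sampleLaw n μ = (sampleLaw n unif).map fun x k => qtl μ (x k) := by
  unfold sampleLaw
  haveI : ∀ _ : Fin n, SigmaFinite (unif.map (qtl μ)) := fun _ => by
    rw [map_qtl]; infer_instance
  rw [Measure.pi_map_pi (fun _ => (measurable_qtl μ).aemeasurable)]
  simp_rw [map_qtl]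

lemma sort_qtl {n : ℕ} (μ : Measure ℝ) [IsProbabilityMeasure μ] (x : Fin n → ℝ)
    (hx : ∀ k, x k ∈ Set.Ioo (0:ℝ) 1) (i : Fin n) :
    sortTuple (fun k => qtl μ (x k)) i = qtl μ (sortTuple x i) := by
  have h : Monotone ((fun k => qtl μ (x k)) ∘ Tuple.sort x) := fun k l hkl =>
    qtl_mono μ (hx _) (hx _) (Tuple.monotone_sort x hkl)
  have := Tuple.unique_monotone (Tuple.monotone_sort (fun k => qtl μ (x k))) h
  exact congrFun this i

lemma ae_Ioo (n : ℕ) : ∀ᵐ x ∂(sampleLaw n unif), ∀ k, x k ∈ Set.Ioo (0:ℝ) 1 := by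
  rw [ae_all_iff]
  intro k
  have h : ∀ᵐ y ∂unif, y ∈ Set.Ioo (0:ℝ) 1 := ae_restrict_mem measurableSet_Ioo
  exact (Measure.quasiMeasurePreserving_eval (fun _ : Fin n => unif) k).ae h

lemma measurable_mapq (n : ℕ) (μ : Measure ℝ) [IsProbabilityMeasure μ] :
    Measurable (fun (x : Fin n → ℝ) k => qtl μ (x k)) :=
  measurable_pi_lambda _ fun k => (measurable_qtl μ).comp (measurable_pi_apply k)

lemma osLaw_map {n : ℕ} (μ : Measure ℝ) [IsProbabilityMeasure μ] (i : Fin n) :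
    osLaw n μ i = (osLaw n unif i).map (qtl μ) := by
  unfold osLaw
  rw [sampleLaw_map n μ, Measure.map_map (measurable_sortTuple i) (measurable_mapq n μ),
    Measure.map_map (measurable_qtl μ) (measurable_sortTuple i)]
  refine Measure.map_congr ?_
  filter_upwards [ae_Ioo n] with x hx
  exact sort_qtl μ x hx i

lemma measurable_pair {n : ℕ} (i j : Fin n) :
    Measurable (fun x : Fin n → ℝ => (sortTuple x i, sortTuple x j)) :=
  (measurable_sortTuple i).prodMk (measurable_sortTuple j)

lemma joint_map {n : ℕ} (μ : Measure ℝ) [IsProbabilityMeasure μ] (i j : Fin n) :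
    ((sampleLaw n μ).map fun x => (sortTuple x i, sortTuple x j)) =
      ((sampleLaw n unif).map fun x => (sortTuple x i, sortTuple x j)).map
        (Prod.map (qtl μ) (qtl μ)) := by
  have hp := measurable_pair i j
  rw [sampleLaw_map n μ, Measure.map_map hp (measurable_mapq n μ),
    Measure.map_map ((measurable_qtl μ).prodMap (measurable_qtl μ)) hp]
  refine Measure.map_congr ?_
  filter_upwards [ae_Ioo n] with x hx
  exact Prod.ext (sort_qtl μ x hx i) (sort_qtl μ x hx j)

lemma kl_map_le {α β : Type*} [MeasurableSpace α] [MeasurableSpace β] (P Q : Measure α)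
    [IsProbabilityMeasure P] [IsProbabilityMeasure Q] (hac : P ≪ Q)
    (hllr : Integrable (llr P Q) P) (g : α → β) (hg : Measurable g) :
    klDiv (P.map g) (Q.map g) ≤ klDiv P Q := by
  haveI : IsProbabilityMeasure (P.map g) := Measure.isProbabilityMeasure_map hg.aemeasurable
  haveI : IsProbabilityMeasure (Q.map g) := Measure.isProbabilityMeasure_map hg.aemeasurable
  have hac2 := hac.map hg
  have hllr2 := InformationTheory.integrable_llr_map hac hg hllr
  have h := InformationTheory.klDiv_map_le (μ := P) (ν := Q) hg
  rw [InformationTheory.klDiv_of_ac_of_integrable hac hllr,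
    InformationTheory.klDiv_of_ac_of_integrable hac2 hllr2,
    ENNReal.ofReal_le_ofReal_iff
      (InformationTheory.integral_llr_add_sub_measure_univ_nonneg hac hllr)] at h
  simp only [probReal_univ, add_sub_cancel_right] at h
  rw [klDiv, klDiv, if_pos hac, if_pos hac2]
  exact EReal.coe_le_coe_iff.2 h

/-- For an arbitrary sampling distribution, the mutual information between the `r`-th and
`m`-th order statistics (1-based) is upper bounded by that of the uniform distribution,
which equals `T_(m-1) + T_(n-r) - T_(m-r-1) - T_n`. -/
theorem mutualInfo_orderStatistics_le_uniform
    (n : ℕ) (μ : Measure ℝ) [IsProbabilityMeasure μ]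
    (r m : ℕ) (hr : 1 ≤ r) (hrm : r < m) (hmn : m ≤ n) :
    miPair n μ ⟨r - 1, by omega⟩ ⟨m - 1, by omega⟩ ≤
        miPair n unif ⟨r - 1, by omega⟩ ⟨m - 1, by omega⟩ ∧
      miPair n unif ⟨r - 1, by omega⟩ ⟨m - 1, by omega⟩
        = ((T (m - 1) + T (n - r) - T (m - r - 1) - T n : ℝ) : EReal) := by
  set i : Fin n := ⟨r - 1, by omega⟩ with hi
  set j : Fin n := ⟨m - 1, by omega⟩ with hj
  have hJ := joint_eq_s18 (n := n) (a := r - 1) (b := m - r - 1) (d := n - m) (i := i) (j := j)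
    rfl (by rw [hj]; change m - 1 = _; omega) (by omega)
  obtain ⟨hac, hllr, hval⟩ := JL_kl (r - 1) (m - r - 1) (n - m)
  haveI := JL_prob (r - 1) (m - r - 1) (n - m)
  have hp := measurable_pair i j
  have h1 : osLaw n unif i = (JL (r - 1) (m - r - 1) (n - m)).map Prod.fst := by
    rw [← hJ, Measure.map_map measurable_fst hp]; rfl
  have h2 : osLaw n unif j = (JL (r - 1) (m - r - 1) (n - m)).map Prod.snd := by
    rw [← hJ, Measure.map_map measurable_snd hp]; rfl
  haveI : IsProbabilityMeasure ((JL (r - 1) (m - r - 1) (n - m)).map Prod.fst) :=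
    Measure.isProbabilityMeasure_map measurable_fst.aemeasurable
  haveI : IsProbabilityMeasure ((JL (r - 1) (m - r - 1) (n - m)).map Prod.snd) :=
    Measure.isProbabilityMeasure_map measurable_snd.aemeasurable
  have hq := measurable_qtl μ
  constructor
  · rw [miPair, miPair, joint_map, osLaw_map μ i, osLaw_map μ j, hJ, h1, h2,
      Measure.map_prod_map _ _ hq hq]
    exact kl_map_le _ _ hac hllr _ (hq.prodMap hq)
  · rw [miPair, hJ, h1, h2, klDiv, if_pos hac]
    congr 1
    refine Eq.trans hval ?_
    have e1 : r - 1 + (m - r - 1) + 1 = m - 1 := by omega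
    have e2 : m - r - 1 + (n - m) + 1 = n - r := by omega
    have e3 : r - 1 + (m - r - 1) + (n - m) + 2 = n := by omega
    rw [e1, e2, e3]
end
end
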